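/- Let G be a minimal counterexample, and let V(G) be partitioned into sets X and Y, each containing at least two vertices, such that the set [X,Y] of edges of G with one endpoint in X and one endpoint in Y has exactly three elements. Then [X,Y] is an induced matching in G: no two of the three edges share a vertex, and no edge of G joins two of the three edges. -/

import Mathlib

open SimpleGraph

/-- A `(1,2^k)`-packing edge-coloring encoded as a function assigning a color in
`Fin (k+1)` to each unordered pair. Color `0` is the 1-color (its class must be a
matching) and each color `i ≠ 0` is a 2-color (its class must be an induced matching). -/
def IsPackingEC {V : Type} (G : SimpleGraph V) (k : ℕ)
    (c : Sym2 V → Fin (k + 1)) : Prop :=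
  (∀ a b x y : V, G.Adj a b → G.Adj x y → s(a, b) ≠ s(x, y) →
      c s(a, b) = 0 → c s(x, y) = 0 →
      a ≠ x ∧ a ≠ y ∧ b ≠ x ∧ b ≠ y) ∧
  ∀ a b x y : V, G.Adj a b → G.Adj x y → s(a, b) ≠ s(x, y) →
      c s(a, b) = c s(x, y) → c s(a, b) ≠ 0 →
      (a ≠ x ∧ a ≠ y ∧ b ≠ x ∧ b ≠ y) ∧
      ¬G.Adj a x ∧ ¬G.Adj a y ∧ ¬G.Adj b x ∧ ¬G.Adj b y

/-- A good coloring: a `(1,2^7)`-packing edge-coloring in which every edge of the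
1-color class (color `0`) has both endpoints of degree 3. -/
def GoodColoring {V : Type} (G : SimpleGraph V) (c : Sym2 V → Fin 8) : Prop :=
  IsPackingEC G 7 c ∧
  ∀ a b : V, G.Adj a b → c s(a, b) = 0 →
    (G.neighborSet a).ncard = 3 ∧ (G.neighborSet b).ncard = 3

/-- A graph is subcubic if every vertex has degree at most 3. -/
def Subcubic {V : Type} (G : SimpleGraph V) : Prop :=
  ∀ v : V, (G.neighborSet v).ncard ≤ 3

/-- A minimal counterexample: a finite subcubic simple graph with no good coloring such
that every finite subcubic simple graph with smaller `|V| + |E|` has a good coloring. -/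
def MinCounter (V : Type) [Finite V] (G : SimpleGraph V) : Prop :=
  Subcubic G ∧
  (¬∃ c : Sym2 V → Fin 8, GoodColoring G c) ∧
  ∀ (W : Type) [Finite W] (H : SimpleGraph W), Subcubic H →
    Nat.card W + H.edgeSet.ncard < Nat.card V + G.edgeSet.ncard →
    ∃ c : Sym2 W → Fin 8, GoodColoring H c

/-- The edge cut `[X, Xᶜ]`: the set of edges of `G` with one endpoint in `X` and the
other in its complement. -/
def cutEdges {V : Type} (G : SimpleGraph V) (X : Set V) : Set (Sym2 V) :=
  {e | e ∈ G.edgeSet ∧ ∃ a ∈ X, ∃ b ∈ Xᶜ, e = s(a, b)}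

section Api

variable {V : Type} {G H : SimpleGraph V}

/-- Two edges are near each other if they share a vertex or are joined by an edge. -/
def Near (G : SimpleGraph V) (e f : Sym2 V) : Prop :=
  ∃ a ∈ e, ∃ b ∈ f, a = b ∨ G.Adj a b

/-- `c` restricted to the set of edges `E` obeys the rules of a good coloring of `G`. -/
structure GoodOn (G : SimpleGraph V) (E : Set (Sym2 V)) (c : Sym2 V → Fin 8) : Prop where
  zero : ∀ e ∈ E, ∀ f ∈ E, e ≠ f → c e = 0 → c f = 0 → ∀ v ∈ e, v ∉ f
  pos : ∀ e ∈ E, ∀ f ∈ E, e ≠ f → c e = c f → c e ≠ 0 → ¬Near G e f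
  deg : ∀ e ∈ E, c e = 0 → ∀ v ∈ e, (G.neighborSet v).ncard = 3

lemma Near.symm {e f : Sym2 V} (h : Near G e f) : Near G f e := by
  obtain ⟨a, ha, b, hb, h⟩ := h
  exact ⟨b, hb, a, ha, h.imp Eq.symm fun h => h.symm⟩

lemma goodColoring_iff (c : Sym2 V → Fin 8) : GoodColoring G c ↔ GoodOn G G.edgeSet c := by
  constructor
  · rintro ⟨⟨h0, h1⟩, h2⟩
    refine ⟨?_, ?_, ?_⟩
    · intro e he f hf hne hce hcf v hve hvf
      induction e with | _ a b
      induction f with | _ x y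
      have := h0 a b x y he hf hne hce hcf
      simp only [Sym2.mem_iff] at hve hvf
      grind
    · rintro e he f hf hne hc hc0 ⟨p, hp, q, hq, hpq⟩
      induction e with | _ a b
      induction f with | _ x y
      have := h1 a b x y he hf hne hc hc0
      simp only [Sym2.mem_iff] at hp hq
      grind
    · intro e he hc v hv
      induction e with | _ a b
      have := h2 a b he hc
      simp only [Sym2.mem_iff] at hv
      grind
  · rintro ⟨h0, h1, h2⟩
    refine ⟨⟨?_, ?_⟩, ?_⟩
    · intro a b x y he hf hne hce hcf
      have := h0 _ he _ hf hne hce hcf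
      simp only [Sym2.mem_iff] at this
      grind
    · intro a b x y he hf hne hc hc0
      have := h1 _ he _ hf hne hc hc0
      simp only [Near, Sym2.mem_iff] at this
      grind
    · intro a b he hc
      have := h2 _ he hc
      simp only [Sym2.mem_iff] at this
      grind

namespace GoodOn

variable {E F : Set (Sym2 V)} {c c' : Sym2 V → Fin 8}

lemma congr (h : GoodOn G E c) (hc : ∀ e ∈ E, c' e = c e) : GoodOn G E c' where
  zero e he f hf := by rw [hc e he, hc f hf]; exact h.zero e he f hf
  pos e he f hf := by rw [hc e he, hc f hf]; exact h.pos e he f hf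
  deg e he := by rw [hc e he]; exact h.deg e he

lemma perm (h : GoodOn G E c) (π : Equiv.Perm (Fin 8)) (hπ : π 0 = 0) :
    GoodOn G E fun e => π (c e) := by
  have h0 : ∀ x, π x = 0 ↔ x = 0 := fun x => by rw [← hπ, π.apply_eq_iff_eq, hπ]
  refine ⟨fun e he f hf => ?_, fun e he f hf => ?_, fun e he => ?_⟩
  · simpa only [h0] using h.zero e he f hf
  · simpa only [π.apply_eq_iff_eq, ne_eq, h0] using h.pos e he f hf
  · simpa only [h0] using h.deg e he

/-- Colors of one more edge may be added when they do not clash. -/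
lemma insert_edge (h : GoodOn G E c) {e : Sym2 V}
    (h0 : c e = 0 → (∀ f ∈ E, c f = 0 → ∀ v ∈ e, v ∉ f) ∧
      ∀ v ∈ e, (G.neighborSet v).ncard = 3)
    (h1 : c e ≠ 0 → ∀ f ∈ E, f ≠ e → c f = c e → ¬Near G e f) :
    GoodOn G (insert e E) c := by
  refine ⟨?_, ?_, ?_⟩
  · rintro f (rfl | hf) g (rfl | hg) hne hcf hcg
    · exact absurd rfl hne
    · exact (h0 hcf).1 g hg hcg
    · intro v hv hv'
      exact (h0 hcg).1 f hf hcf v hv' hv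
    · exact h.zero f hf g hg hne hcf hcg
  · rintro f (rfl | hf) g (rfl | hg) hne hc hc0
    · exact absurd rfl hne
    · exact h1 hc0 g hg hne.symm hc.symm
    · intro hn
      exact h1 (hc ▸ hc0) f hf hne hc hn.symm
    · exact h.pos f hf g hg hne hc hc0
  · rintro f (rfl | hf) hc
    · exact (h0 hc).2
    · exact h.deg f hf hc

end GoodOn

/-- The edges of `G` with both endpoints in `W`. -/
def inside (G : SimpleGraph V) (W : Set V) : Set (Sym2 V) :=
  {e | e ∈ G.edgeSet ∧ ∀ v ∈ e, v ∈ W}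

lemma mem_inside {W : Set V} {a b : V} : s(a, b) ∈ inside G W ↔ G.Adj a b ∧ a ∈ W ∧ b ∈ W := by
  simp [inside]

/-- The graph with the edges of `G` inside `W`. -/
def within (G : SimpleGraph V) (W : Set V) : SimpleGraph V where
  Adj a b := G.Adj a b ∧ a ∈ W ∧ b ∈ W
  symm := ⟨fun _ _ h => ⟨h.1.symm, h.2.2, h.2.1⟩⟩
  loopless := ⟨fun _ h => h.1.ne rfl⟩

lemma within_edgeSet (W : Set V) : (within G W).edgeSet = inside G W := by
  ext e
  induction e with | _ a b
  rw [mem_inside]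
  rfl

lemma GoodColoring.goodOn_inside {c : Sym2 V → Fin 8} (h : GoodColoring H c) (W : Set V)
    (hW : ∀ a ∈ W, ∀ b ∈ W, G.Adj a b → H.Adj a b)
    (hd : ∀ v ∈ W, (H.neighborSet v).ncard = 3 → (G.neighborSet v).ncard = 3) :
    GoodOn G (inside G W) c := by
  rw [goodColoring_iff] at h
  have hsub : ∀ e ∈ inside G W, e ∈ H.edgeSet := by
    intro e he
    induction e with | _ a b
    rw [mem_inside] at he
    exact hW a he.2.1 b he.2.2 he.1
  refine ⟨fun e he f hf => h.zero e (hsub e he) f (hsub f hf), ?_, ?_⟩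
  · rintro e he f hf hne hc hc0 ⟨a, ha, b, hb, hab⟩
    exact h.pos e (hsub e he) f (hsub f hf) hne hc hc0
      ⟨a, ha, b, hb, hab.imp_right (hW a (he.2 a ha) b (hf.2 b hb))⟩
  · intro e he hc v hv
    exact hd v (he.2 v hv) (h.deg e (hsub e he) hc v hv)

lemma GoodColoring.ne_zero {c : Sym2 V → Fin 8} (h : GoodColoring H c) {a b : V}
    (hab : H.Adj a b) (hd : (H.neighborSet a).ncard ≤ 2) : c s(a, b) ≠ 0 := by
  intro h0
  have := (h.2 a b hab h0).1
  omega

lemma MinCounter.exists_good [Finite V] (hG : MinCounter V G) (H : SimpleGraph V)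
    (hH : Subcubic H) (h : H.edgeSet.ncard < G.edgeSet.ncard) : ∃ c, GoodColoring H c :=
  hG.2.2 V H hH (by omega)

lemma MinCounter.not_goodOn [Finite V] (hG : MinCounter V G) {c : Sym2 V → Fin 8} :
    ¬GoodOn G G.edgeSet c := fun h => hG.2.1 ⟨c, (goodColoring_iff c).2 h⟩

lemma near_other {a b : V} {f : Sym2 V} (hf : f ∈ G.edgeSet) (hne : f ≠ s(a, b))
    (h : Near G s(a, b) f) : ∃ x ∈ f, (G.Adj a x ∧ x ≠ b) ∨ (G.Adj b x ∧ x ≠ a) := by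
  obtain ⟨p, hp, q, hq, h⟩ := h
  induction f with | _ x y
  have hxy : G.Adj x y := hf
  have hyx := hxy.symm
  simp only [Sym2.mem_iff] at hp hq ⊢
  simp only [ne_eq, Sym2.eq_iff, not_or, not_and] at hne
  grind

open Classical in
/-- The nonzero colors that the edges of `E` at the vertex `x` receive. -/
noncomputable def seen (c : Sym2 V → Fin 8) (E : Set (Sym2 V)) (x : V) : Finset (Fin 8) :=
  Finset.univ.filter fun t => t ≠ 0 ∧ ∃ f ∈ E, x ∈ f ∧ c f = t

lemma mem_seen {c : Sym2 V → Fin 8} {E : Set (Sym2 V)} {x : V} {t : Fin 8} :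
    t ∈ seen c E x ↔ t ≠ 0 ∧ ∃ f ∈ E, x ∈ f ∧ c f = t := by
  simp [seen]

lemma card_seen_le [Finite V] (c : Sym2 V → Fin 8) (E : Set (Sym2 V)) (x : V) :
    (seen c E x).card ≤ {f | f ∈ E ∧ x ∈ f}.ncard := by
  have : (seen c E x : Set (Fin 8)) ⊆ c '' {f | f ∈ E ∧ x ∈ f} := by
    intro t ht
    obtain ⟨-, f, hf, hx, rfl⟩ := mem_seen.1 ht
    exact ⟨f, ⟨hf, hx⟩, rfl⟩
  rw [← Set.ncard_coe_finset]
  exact (Set.ncard_le_ncard this).trans (Set.ncard_image_le (Set.toFinite _))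

lemma incident_subset {E : Set (Sym2 V)} (hE : E ⊆ G.edgeSet) (x : V) (N : Set V)
    (hN : ∀ y, s(x, y) ∈ E → y ∈ N) :
    {f | f ∈ E ∧ x ∈ f} ⊆ (fun y => s(x, y)) '' (G.neighborSet x ∩ N) := by
  rintro f ⟨hf, hx⟩
  obtain ⟨y, rfl⟩ := Sym2.mem_iff_exists.1 hx
  exact ⟨y, ⟨hE hf, hN y hf⟩, rfl⟩

lemma card_seen_le_ncard [Finite V] (c : Sym2 V → Fin 8) {E : Set (Sym2 V)}
    (hE : E ⊆ G.edgeSet) (x : V) (N : Set V) (hN : ∀ y, s(x, y) ∈ E → y ∈ N) :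
    (seen c E x).card ≤ (G.neighborSet x ∩ N).ncard :=
  (card_seen_le c E x).trans <| (Set.ncard_le_ncard (incident_subset hE x N hN)).trans
    (Set.ncard_image_le (Set.toFinite _))

lemma card_seen_le_three [Finite V] (hG : Subcubic G) (c : Sym2 V → Fin 8)
    {E : Set (Sym2 V)} (hE : E ⊆ G.edgeSet) (x : V) : (seen c E x).card ≤ 3 := by
  refine (card_seen_le_ncard c hE x Set.univ fun _ _ => trivial).trans ?_
  simpa using hG x

lemma card_seen_le_two [Finite V] (hG : Subcubic G) (c : Sym2 V → Fin 8)
    {E : Set (Sym2 V)} (hE : E ⊆ G.edgeSet) {x y : V} (hxy : G.Adj x y)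
    (hy : s(x, y) ∈ E → c s(x, y) = 0) : (seen c E x).card ≤ 2 := by
  have : seen c E x ⊆ seen c (E \ {s(x, y)}) x := by
    intro t ht
    obtain ⟨h0, f, hf, hx, rfl⟩ := mem_seen.1 ht
    refine mem_seen.2 ⟨h0, f, ⟨hf, ?_⟩, hx, rfl⟩
    rintro rfl
    exact h0 (hy hf)
  refine (Finset.card_le_card this).trans <| (card_seen_le_ncard c
    (Set.sdiff_subset.trans hE) x {y}ᶜ ?_).trans ?_
  · rintro z hz rfl
    exact hz.2 rfl
  · have := Set.ncard_sdiff_singleton_of_mem (show y ∈ G.neighborSet x from hxy)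
    rw [Set.sdiff_eq] at this
    have := hG x
    omega

open Classical in
lemma GoodOn.extend {E : Set (Sym2 V)} {c : Sym2 V → Fin 8} (h : GoodOn G E c)
    (hE : E ⊆ G.edgeSet) {a b : V} (hne : s(a, b) ∉ E) {t : Fin 8} (ht : t ≠ 0)
    (hs : ∀ x, (G.Adj a x ∧ x ≠ b) ∨ (G.Adj b x ∧ x ≠ a) → t ∉ seen c E x) :
    GoodOn G (insert s(a, b) E) (Function.update c s(a, b) t) := by
  have hu : ∀ f ∈ E, Function.update c s(a, b) t f = c f := fun f hf =>
    Function.update_of_ne (by rintro rfl; exact hne hf) _ _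
  refine (h.congr hu).insert_edge (fun h0 => absurd (by simpa using h0) ht) ?_
  intro _ f hf hfe hcf hn
  rw [Function.update_self, hu f hf] at hcf
  obtain ⟨x, hx, hx'⟩ := near_other (hE hf) hfe hn
  exact hs x hx' (mem_seen.2 ⟨ht, f, hf, hx, hcf⟩)

open Classical in
lemma GoodOn.extend_zero {E : Set (Sym2 V)} {c : Sym2 V → Fin 8} (h : GoodOn G E c)
    {a b : V} (hne : s(a, b) ∉ E) (ha : (G.neighborSet a).ncard = 3)
    (hb : (G.neighborSet b).ncard = 3)
    (hs : ∀ f ∈ E, a ∈ f ∨ b ∈ f → c f ≠ 0) :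
    GoodOn G (insert s(a, b) E) (Function.update c s(a, b) 0) := by
  have hu : ∀ f ∈ E, Function.update c s(a, b) 0 f = c f := fun f hf =>
    Function.update_of_ne (by rintro rfl; exact hne hf) _ _
  refine (h.congr hu).insert_edge (fun _ => ⟨?_, ?_⟩) (fun h0 => absurd (by simp) h0)
  · intro f hf hcf v hv hvf
    rw [hu f hf] at hcf
    rcases Sym2.mem_iff.1 hv with rfl | rfl
    · exact hs f hf (.inl hvf) hcf
    · exact hs f hf (.inr hvf) hcf
  · intro v hv
    rcases Sym2.mem_iff.1 hv with rfl | rfl <;> assumption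

lemma exists_color {T : Finset (Fin 8)} (hT : T.card ≤ 6) : ∃ t, t ≠ 0 ∧ t ∉ T := by
  by_contra! h
  have : (Finset.univ : Finset (Fin 8)) ⊆ insert 0 T := fun t _ => by
    by_cases h0 : t = 0
    · simp [h0]
    · exact Finset.mem_insert_of_mem (h t h0)
  have := Finset.card_le_card this
  have := Finset.card_insert_le 0 T
  simp at *
  omega

open Classical in
lemma seen_update_subset {E : Set (Sym2 V)} {c : Sym2 V → Fin 8} {e : Sym2 V} {t : Fin 8}
    (x : V) : seen (Function.update c e t) (insert e E) x ⊆ insert t (seen c E x) := by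
  intro k hk
  obtain ⟨h0, f, hf, hx, rfl⟩ := mem_seen.1 hk
  by_cases hfe : f = e
  · simp [hfe]
  · rw [Function.update_of_ne hfe] at *
    exact Finset.mem_insert_of_mem
      (mem_seen.2 ⟨h0, f, hf.resolve_left hfe, hx, rfl⟩)

open Classical in
lemma seen_update_of_notMem {E : Set (Sym2 V)} {c : Sym2 V → Fin 8} {e : Sym2 V} {t : Fin 8}
    {x : V} (hx : x ∉ e) : seen (Function.update c e t) (insert e E) x ⊆ seen c E x := by
  intro k hk
  obtain ⟨h0, f, hf, hxf, rfl⟩ := mem_seen.1 hk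
  have hfe : f ≠ e := by rintro rfl; exact hx hxf
  rw [Function.update_of_ne hfe] at *
  exact mem_seen.2 ⟨h0, f, hf.resolve_left hfe, hxf, rfl⟩

end Api

section Basic

variable {V : Type} {G H : SimpleGraph V} {A : Set V} {c c' : Sym2 V → Fin 8}

lemma inside_subset (W : Set V) : inside G W ⊆ G.edgeSet := fun _ h => h.1

lemma GoodOn.mono {E F : Set (Sym2 V)} (h : GoodOn G E c) (hF : F ⊆ E) : GoodOn G F c where
  zero e he f hf := h.zero e (hF he) f (hF hf)
  pos e he f hf := h.pos e (hF he) f (hF hf)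
  deg e he := h.deg e (hF he)

/-- Few vertices that each see few colors see few colors together. -/
lemma exists_seen_bound [Finite V] (c : Sym2 V → Fin 8) (E : Set (Sym2 V)) (N : Set V) {k : ℕ}
    (hk : ∀ x ∈ N, (seen c E x).card ≤ k) :
    ∃ T : Finset (Fin 8), T.card ≤ N.ncard * k ∧ ∀ x ∈ N, seen c E x ⊆ T := by
  classical
  have hN : N.Finite := Set.toFinite N
  refine ⟨hN.toFinset.biUnion (seen c E), ?_, fun x hx => ?_⟩
  · rw [Set.ncard_eq_toFinset_card N hN]
    exact Finset.card_biUnion_le_card_mul _ _ _ fun x hx => hk x (hN.mem_toFinset.1 hx)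
  · exact Finset.subset_biUnion_of_mem (seen c E) (hN.mem_toFinset.2 hx)

lemma Subcubic.ncard_diff_le [Finite V] (hG : Subcubic G) {a b : V} (hab : G.Adj a b) :
    (G.neighborSet a \ {b}).ncard ≤ 2 := by
  have := Set.ncard_sdiff_singleton_of_mem (show b ∈ G.neighborSet a from hab)
  have := hG a
  omega

lemma Subcubic.ncard_diff_pair_le [Finite V] (hG : Subcubic G) {a b d : V} (hab : G.Adj a b)
    (had : G.Adj a d) (hbd : b ≠ d) : (G.neighborSet a \ {b, d}).ncard ≤ 1 := by
  have h : ({b, d} : Set V) ⊆ G.neighborSet a := by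
    rintro x (rfl | rfl) <;> assumption
  have := Set.ncard_sdiff h
  rw [Set.ncard_pair hbd] at this
  have := hG a
  omega

lemma GoodColoring.notMem_seen (h : GoodColoring H c) {E : Set (Sym2 V)} {a b x : V}
    (hE : E ⊆ H.edgeSet) (hab : H.Adj a b) (hn : s(a, b) ∉ E)
    (hx : x = a ∨ H.Adj a x ∨ H.Adj b x) : c s(a, b) ∉ seen c E x := by
  intro hm
  obtain ⟨h0, f, hf, hxf, hc⟩ := mem_seen.1 hm
  refine ((goodColoring_iff c).1 h).pos s(a, b) hab f (hE hf) (by rintro rfl; exact hn hf)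
    hc.symm h0 ?_
  rcases hx with rfl | hx | hx
  · exact ⟨x, by simp, x, hxf, .inl rfl⟩
  · exact ⟨a, by simp, x, hxf, .inr hx⟩
  · exact ⟨b, by simp, x, hxf, .inr hx⟩

lemma edgeSet_ncard_lt [Finite V] {R S : Set (Sym2 V)} (hR : R ⊆ G.edgeSet)
    (hH : H.edgeSet ⊆ (G.edgeSet \ R) ∪ S) (hS : S.ncard < R.ncard) :
    H.edgeSet.ncard < G.edgeSet.ncard := by
  have h1 := Set.ncard_le_ncard hH
  have h2 := Set.ncard_union_le (G.edgeSet \ R) S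
  have h3 := Set.ncard_sdiff_add_ncard_of_subset hR
  omega

lemma Subcubic.of_le [Finite V] (hG : Subcubic G) (h : H ≤ G) : Subcubic H := fun v =>
  (Set.ncard_le_ncard fun _ hx => h hx).trans (hG v)

lemma within_le (W : Set V) : within G W ≤ G := fun _ _ h => h.1

/-- Colorings of the two sides that agree nowhere across the cut can be combined. -/
lemma GoodOn.glue (hc : GoodOn G (inside G A) c) (hc' : GoodOn G (inside G Aᶜ) c')
    (hx : ∀ a ∈ A, ∀ b ∈ Aᶜ, G.Adj a b →
      Disjoint (seen c (inside G A) a) (seen c' (inside G Aᶜ) b)) :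
    ∃ C, GoodOn G (inside G A ∪ inside G Aᶜ) C ∧
      (∀ e ∈ inside G A, C e = c e) ∧ ∀ e ∈ inside G Aᶜ, C e = c' e := by
  classical
  have hdis : ∀ e ∈ inside G Aᶜ, e ∉ inside G A := by
    intro e he he'
    induction e with | _ a b
    exact (mem_inside.1 he).2.1 (mem_inside.1 he').2.1
  set C : Sym2 V → Fin 8 := fun e => if e ∈ inside G A then c e else c' e with hC
  have h1 : ∀ e ∈ inside G A, C e = c e := fun e he => if_pos he
  have h2 : ∀ e ∈ inside G Aᶜ, C e = c' e := fun e he => if_neg (hdis e he)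
  have hcross : ∀ e ∈ inside G A, ∀ f ∈ inside G Aᶜ, C e = C f → C e ≠ 0 → ¬Near G e f := by
    rintro e he f hf hcef h0 ⟨a, ha, b, hb, hab⟩
    have haA := he.2 a ha
    have hbA := hf.2 b hb
    rcases hab with rfl | hab
    · exact hbA haA
    refine Finset.disjoint_left.1 (hx a haA b hbA hab)
      (mem_seen.2 ⟨h0, e, he, ha, (h1 e he).symm⟩)
      (mem_seen.2 ⟨h0, f, hf, hb, by rw [hcef, h2 f hf]⟩)
  have g1 := hc.congr h1
  have g2 := hc'.congr h2
  refine ⟨C, ⟨?_, ?_, ?_⟩, h1, h2⟩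
  · rintro e (he | he) f (hf | hf) hne he0 hf0
    · exact g1.zero e he f hf hne he0 hf0
    · intro v hv hv'
      exact hf.2 v hv' (he.2 v hv)
    · intro v hv hv'
      exact he.2 v hv (hf.2 v hv')
    · exact g2.zero e he f hf hne he0 hf0
  · rintro e (he | he) f (hf | hf) hne hef he0
    · exact g1.pos e he f hf hne hef he0
    · exact hcross e he f hf hef he0
    · exact fun hn => hcross f hf e he hef.symm (hef ▸ he0) hn.symm
    · exact g2.pos e he f hf hne hef he0
  · rintro e (he | he)
    · exact g1.deg e he
    · exact g2.deg e he

lemma seen_congr {E F : Set (Sym2 V)} {x : V} (h : ∀ e ∈ E, x ∈ e → e ∈ F ∧ c e = c' e) :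
    seen c E x ⊆ seen c' F x := by
  intro t ht
  obtain ⟨h0, f, hf, hx, rfl⟩ := mem_seen.1 ht
  exact mem_seen.2 ⟨h0, f, (h f hf hx).1, hx, (h f hf hx).2.symm⟩

lemma seen_glue_left (h : ∀ e ∈ inside G A, c' e = c e) {x : V} (hx : x ∈ A) :
    seen c' (inside G A ∪ inside G Aᶜ) x ⊆ seen c (inside G A) x :=
  seen_congr fun e he hxe => he.elim (fun he => ⟨he, h e he⟩) fun he => absurd hx (he.2 x hxe)

lemma seen_glue_right (h : ∀ e ∈ inside G Aᶜ, c' e = c e) {x : V} (hx : x ∈ Aᶜ) :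
    seen c' (inside G A ∪ inside G Aᶜ) x ⊆ seen c (inside G Aᶜ) x :=
  seen_congr fun e he hxe => he.elim (fun he => absurd (he.2 x hxe) hx) fun he => ⟨he, h e he⟩

lemma mem_seen_perm {E : Set (Sym2 V)} {π : Equiv.Perm (Fin 8)} (hπ : π 0 = 0) {x : V}
    {t : Fin 8} : t ∈ seen (fun e => π (c e)) E x ↔ ∃ k ∈ seen c E x, π k = t := by
  constructor
  · intro h
    obtain ⟨h0, f, hf, hx, rfl⟩ := mem_seen.1 h
    exact ⟨c f, mem_seen.2 ⟨fun h => h0 (by rw [h, hπ]), f, hf, hx, rfl⟩, rfl⟩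
  · rintro ⟨k, hk, rfl⟩
    obtain ⟨h0, f, hf, hx, rfl⟩ := mem_seen.1 hk
    exact mem_seen.2 ⟨fun h => h0 (π.injective (h.trans hπ.symm)), f, hf, hx, rfl⟩

/-- Greedy extension of an injection of colors. -/
lemma exists_injOn_extension (f : Fin 8 → Fin 8) (S T : Finset (Fin 8))
    (hf : Set.InjOn f S) (B : Fin 8 → Finset (Fin 8))
    (hB : ∀ k ∈ T, k ∉ S → (S ∪ T).card + (B k).card ≤ 8) :
    ∃ g : Fin 8 → Fin 8, Set.InjOn g (S ∪ T : Finset (Fin 8)) ∧ (∀ k ∈ S, g k = f k) ∧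
      ∀ k ∈ T, k ∉ S → g k ∉ B k := by
  induction T using Finset.induction_on with
  | empty => exact ⟨f, by simpa using hf, fun _ _ => rfl, by simp⟩
  | insert k T hk ih =>
    obtain ⟨g, hg, hgS, hgB⟩ := ih fun j hj hjS => by
      refine (Nat.add_le_add_right (Finset.card_le_card ?_) _).trans
        (hB j (Finset.mem_insert_of_mem hj) hjS)
      exact Finset.union_subset_union_right (Finset.subset_insert _ _)
    by_cases hkS : k ∈ S
    · refine ⟨g, ?_, hgS, ?_⟩
      · rwa [Finset.union_insert, Finset.insert_eq_of_mem (Finset.mem_union_left _ hkS)]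
      · intro j hj hjS
        rcases Finset.mem_insert.1 hj with rfl | hj
        · exact absurd hkS hjS
        · exact hgB j hj hjS
    have hkST : k ∉ S ∪ T := by simp [hkS, hk]
    have hcard := hB k (Finset.mem_insert_self _ _) hkS
    rw [Finset.union_insert, Finset.card_insert_of_notMem hkST] at hcard
    obtain ⟨t, ht⟩ : ∃ t, t ∉ (S ∪ T).image g ∪ B k := by
      by_contra! h
      have h1 : (Finset.univ : Finset (Fin 8)) ⊆ (S ∪ T).image g ∪ B k := fun t _ => h t
      have h1 := Finset.card_le_card h1
      have h2 := Finset.card_union_le ((S ∪ T).image g) (B k)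
      have h3 := Finset.card_image_le (s := S ∪ T) (f := g)
      rw [Finset.card_univ, Fintype.card_fin] at h1
      omega
    rw [Finset.mem_union, not_or] at ht
    have hu : ∀ j ∈ S ∪ T, Function.update g k t j = g j := fun j hj =>
      Function.update_of_ne (by rintro rfl; exact hkST hj) _ _
    refine ⟨Function.update g k t, ?_, fun j hj => ?_, fun j hj hjS => ?_⟩
    · rw [Finset.union_insert, Finset.coe_insert, Set.injOn_insert (by exact_mod_cast hkST)]
      refine ⟨hg.congr fun j hj => (hu j hj).symm, ?_⟩
      rintro ⟨j, hj, hjt⟩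
      rw [Function.update_self, hu j hj] at hjt
      exact ht.1 (Finset.mem_image.2 ⟨j, hj, hjt⟩)
    · rw [hu j (Finset.mem_union_left _ hj), hgS j hj]
    · rcases Finset.mem_insert.1 hj with rfl | hj
      · rw [Function.update_self]
        exact ht.2
      · rw [hu j (Finset.mem_union_right _ hj)]
        exact hgB j hj hjS

lemma exists_perm_eqOn {g : Fin 8 → Fin 8} {S : Finset (Fin 8)} (hg : Set.InjOn g S) :
    ∃ π : Equiv.Perm (Fin 8), ∀ k ∈ S, π k = g k := by
  obtain ⟨π, hπ⟩ := Set.MapsTo.exists_equiv_extend_of_card_eq (t := (Finset.univ : Finset (Fin 8)))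
    (by simp) (f := g) (s := (S : Set (Fin 8))) (fun _ _ => by simp) hg
  refine ⟨π.trans (Equiv.subtypeUnivEquiv fun x => Finset.mem_univ x), fun k hk => ?_⟩
  exact hπ k hk

variable [Finite V]

lemma MinCounter.exists_adj (hG : MinCounter V G) (v : V) : ∃ w, G.Adj v w := by
  by_contra! hv
  set H : SimpleGraph {x // x ≠ v} := G.comap Subtype.val
  have hinj : Function.Injective (Sym2.map (Subtype.val : {x // x ≠ v} → V)) :=
    Sym2.map.injective Subtype.val_injective
  have hdeg : ∀ x : {x // x ≠ v}, (H.neighborSet x).ncard = (G.neighborSet x).ncard := by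
    intro x
    rw [← Set.ncard_image_of_injective _ Subtype.val_injective]
    congr 1
    ext y
    constructor
    · rintro ⟨y, hy, rfl⟩
      exact hy
    · intro hy
      exact ⟨⟨y, by rintro rfl; exact hv x (SimpleGraph.Adj.symm hy)⟩, hy, rfl⟩
  have hcard : Nat.card {x // x ≠ v} < Nat.card V :=
    Finite.card_subtype_lt (x := v) (by simp)
  have hedge : H.edgeSet.ncard ≤ G.edgeSet.ncard := by
    rw [← Set.ncard_image_of_injective _ hinj]
    refine Set.ncard_le_ncard ?_
    rintro _ ⟨e, he, rfl⟩
    induction e with | _ a b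
    exact he
  obtain ⟨c, hc⟩ := hG.2.2 _ H (fun x => (hdeg x).trans_le (hG.1 x)) (by omega)
  refine hG.2.1 ⟨Function.extend (Sym2.map Subtype.val) c 0, ?_⟩
  have hext : ∀ a b : {x // x ≠ v},
      Function.extend (Sym2.map Subtype.val) c 0 s(a.1, b.1) = c s(a, b) := fun a b =>
    hinj.extend_apply c 0 s(a, b)
  have hne : ∀ {a b}, G.Adj a b → a ≠ v := by
    rintro a b h rfl
    exact hv _ h
  refine ⟨⟨?_, ?_⟩, ?_⟩
  · intro a b x y hab hxy hs h0 h0'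
    lift a to {x // x ≠ v} using hne hab
    lift b to {x // x ≠ v} using hne hab.symm
    lift x to {x // x ≠ v} using hne hxy
    lift y to {x // x ≠ v} using hne hxy.symm
    rw [hext] at h0 h0'
    have := hc.1.1 a b x y hab hxy (by rintro h; exact hs (congrArg (Sym2.map Subtype.val) h))
      h0 h0'
    simpa only [ne_eq, Subtype.ext_iff] using this
  · intro a b x y hab hxy hs h0 h0'
    lift a to {x // x ≠ v} using hne hab
    lift b to {x // x ≠ v} using hne hab.symm
    lift x to {x // x ≠ v} using hne hxy
    lift y to {x // x ≠ v} using hne hxy.symm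
    rw [hext] at h0 h0'
    rw [hext] at h0
    have := hc.1.2 a b x y hab hxy (by rintro h; exact hs (congrArg (Sym2.map Subtype.val) h))
      h0 h0'
    exact ⟨by simpa only [ne_eq, Subtype.ext_iff] using this.1, this.2⟩
  · intro a b hab h0
    lift a to {x // x ≠ v} using hne hab
    lift b to {x // x ≠ v} using hne hab.symm
    rw [hext] at h0
    rw [← hdeg a, ← hdeg b]
    exact hc.2 a b hab h0

lemma MinCounter.exists_within (hG : MinCounter V G) (W : Set V) {e : Sym2 V}
    (he : e ∈ G.edgeSet) (hW : e ∉ inside G W) : ∃ c, GoodColoring (within G W) c := by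
  refine hG.exists_good _ (hG.1.of_le (within_le W)) ?_
  rw [within_edgeSet]
  exact Set.ncard_lt_ncard ⟨inside_subset W, fun h => hW (h he)⟩

lemma Subcubic.ncard_eq_of_le (hG : Subcubic G) (h : H ≤ G) {v : V}
    (hv : (H.neighborSet v).ncard = 3) : (G.neighborSet v).ncard = 3 :=
  le_antisymm (hG v) (hv ▸ Set.ncard_le_ncard fun _ hx => h hx)

/-- A minimal counterexample is connected. -/
lemma MinCounter.exists_cut (hG : MinCounter V G) (hA : A.Nonempty) (hA' : Aᶜ.Nonempty) :
    ∃ a ∈ A, ∃ b ∈ Aᶜ, G.Adj a b := by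
  by_contra! h
  have key : ∀ W : Set V, Wᶜ.Nonempty → (∀ a ∈ W, ∀ b ∈ Wᶜ, ¬G.Adj a b) →
      ∃ c, GoodOn G (inside G W) c := by
    rintro W ⟨b, hb⟩ hW
    obtain ⟨d, hbd⟩ := hG.exists_adj b
    obtain ⟨c, hc⟩ := hG.exists_within W (e := s(b, d)) hbd fun h => hb (mem_inside.1 h).2.1
    exact ⟨c, hc.goodOn_inside W (fun a ha b hb hab => ⟨hab, ha, hb⟩)
      fun v _ => hG.1.ncard_eq_of_le (within_le W)⟩
  obtain ⟨c, hc⟩ := key A hA' h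
  obtain ⟨c', hc'⟩ := key Aᶜ (by rwa [compl_compl]) fun a ha b hb hab =>
    h b (by rwa [compl_compl] at hb) a ha hab.symm
  obtain ⟨C, hC, -⟩ := hc.glue hc' fun a ha b hb hab => absurd hab (h a ha b hb)
  refine hG.not_goodOn (hC.mono fun e he => ?_)
  induction e with | _ a b
  have hab : G.Adj a b := he
  have h1 := h a
  have h2 := h b
  have := hab.symm
  rw [Set.mem_union, mem_inside, mem_inside]
  by_cases ha : a ∈ A <;> by_cases hb : b ∈ A <;> simp_all

end Basic

section SmallCuts

variable {V : Type} {G H : SimpleGraph V} {A : Set V} {c c' : Sym2 V → Fin 8}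

lemma edge_subset_of_cut {E : Set (Sym2 V)} (hE : inside G A ∪ inside G Aᶜ ⊆ E)
    (h : ∀ a ∈ A, ∀ b ∈ Aᶜ, G.Adj a b → s(a, b) ∈ E) : G.edgeSet ⊆ E := by
  intro e he
  induction e with | _ a b
  have hab : G.Adj a b := he
  by_cases ha : a ∈ A <;> by_cases hb : b ∈ A
  · exact hE (.inl (mem_inside.2 ⟨hab, ha, hb⟩))
  · exact h a ha b hb hab
  · rw [Sym2.eq_swap]
    exact h b hb a ha hab.symm
  · exact hE (.inr (mem_inside.2 ⟨hab, ha, hb⟩))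

lemma cross_notMem {a b : V} (ha : a ∈ A) (hb : b ∈ Aᶜ) :
    s(a, b) ∉ inside G A ∪ inside G Aᶜ := by
  rintro (h | h)
  · exact hb (mem_inside.1 h).2.2
  · exact (mem_inside.1 h).2.1 ha

lemma glue_subset : inside G A ∪ inside G Aᶜ ⊆ G.edgeSet :=
  Set.union_subset (inside_subset _) (inside_subset _)

/-- Inject the colors `G₁`, `G₂` so as to avoid `F₁`, `F₂` respectively. -/
lemma exists_perm_avoiding (f : Fin 8 → Fin 8) {S F₁ F₂ G₁ G₂ : Finset (Fin 8)}
    (hf : Set.InjOn f S) (h₁ : Disjoint S G₁) (h₂ : Disjoint S G₂)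
    (h12 : S.card + (G₁ ∩ G₂).card + (F₁ ∪ F₂).card ≤ 8) (hG₂ : S.card + G₂.card + F₂.card ≤ 8)
    (hG₁ : S.card + (G₁ ∪ G₂).card + F₁.card ≤ 8) :
    ∃ π : Equiv.Perm (Fin 8), (∀ k ∈ S, π k = f k) ∧ (∀ k ∈ G₁, π k ∉ F₁) ∧
      ∀ k ∈ G₂, π k ∉ F₂ := by
  have hu : ∀ T : Finset (Fin 8), (S ∪ T).card ≤ S.card + T.card := fun T =>
    Finset.card_union_le _ _
  obtain ⟨g, hg, hgS, hgB⟩ := exists_injOn_extension f S (G₁ ∩ G₂) hf (fun _ => F₁ ∪ F₂)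
    fun k _ _ => by have := hu (G₁ ∩ G₂); omega
  obtain ⟨g', hg', hgS', hgB'⟩ := exists_injOn_extension g (S ∪ G₁ ∩ G₂) G₂ hg (fun _ => F₂)
    fun k _ _ => by
      rw [Finset.union_assoc, Finset.union_eq_right.2 Finset.inter_subset_right]
      have := hu G₂
      omega
  obtain ⟨g'', hg'', hgS'', hgB''⟩ := exists_injOn_extension g' (S ∪ G₁ ∩ G₂ ∪ G₂) G₁ hg'
    (fun _ => F₁) fun k _ _ => by
      rw [show S ∪ G₁ ∩ G₂ ∪ G₂ ∪ G₁ = S ∪ (G₁ ∪ G₂) by grind]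
      have := hu (G₁ ∪ G₂)
      omega
  obtain ⟨π, hπ⟩ := exists_perm_eqOn hg''
  simp only [Finset.mem_union, Finset.mem_inter, Finset.disjoint_left] at *
  refine ⟨π, fun k hk => ?_, fun k hk => ?_, fun k hk => ?_⟩ <;> grind

/-- `[A, B]` is a cut of `G` consisting of the disjoint edges `a₁b₁` and `a₂b₂`. -/
structure TwoCut (G : SimpleGraph V) (A B : Set V) (a₁ b₁ a₂ b₂ : V) : Prop where
  compl : B = Aᶜ
  mem_a₁ : a₁ ∈ A
  mem_a₂ : a₂ ∈ A
  mem_b₁ : b₁ ∈ B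
  mem_b₂ : b₂ ∈ B
  ne_a : a₁ ≠ a₂
  ne_b : b₁ ≠ b₂
  adj₁ : G.Adj a₁ b₁
  adj₂ : G.Adj a₂ b₂
  cut : ∀ x ∈ A, ∀ y ∈ B, G.Adj x y → x = a₁ ∧ y = b₁ ∨ x = a₂ ∧ y = b₂

/-- A coloring of one side `A` of a cut with two edges at `a₁` and `a₂`, which may receive
the colors `α₁` and `α₂`. -/
structure StarColoring (G : SimpleGraph V) (A : Set V) (a₁ a₂ : V) (c : Sym2 V → Fin 8)
    (α₁ α₂ : Fin 8) : Prop where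
  ne₁ : α₁ ≠ 0
  ne₂ : α₂ ≠ 0
  ne : α₁ ≠ α₂
  good : GoodOn G (inside G A) c
  free₁ : ∀ x ∈ A, x = a₁ ∨ x = a₂ ∨ G.Adj a₁ x → α₁ ∉ seen c (inside G A) x
  free₂ : ∀ x ∈ A, x = a₂ ∨ x = a₁ ∨ G.Adj a₂ x → α₂ ∉ seen c (inside G A) x

lemma TwoCut.symm {B : Set V} {a₁ b₁ a₂ b₂ : V} (h : TwoCut G A B a₁ b₁ a₂ b₂) :
    TwoCut G B A b₁ a₁ b₂ a₂ where
  compl := by rw [h.compl, compl_compl]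
  mem_a₁ := h.mem_b₁
  mem_a₂ := h.mem_b₂
  mem_b₁ := h.mem_a₁
  mem_b₂ := h.mem_a₂
  ne_a := h.ne_b
  ne_b := h.ne_a
  adj₁ := h.adj₁.symm
  adj₂ := h.adj₂.symm
  cut x hx y hy hxy := (h.cut y hy x hx hxy.symm).imp And.symm And.symm

lemma TwoCut.swap {B : Set V} {a₁ b₁ a₂ b₂ : V} (h : TwoCut G A B a₁ b₁ a₂ b₂) :
    TwoCut G A B a₂ b₂ a₁ b₁ :=
  ⟨h.compl, h.mem_a₂, h.mem_a₁, h.mem_b₂, h.mem_b₁, h.ne_a.symm, h.ne_b.symm, h.adj₂, h.adj₁,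
    fun x hx y hy hxy => (h.cut x hx y hy hxy).symm⟩

lemma StarColoring.swap {a₁ a₂ : V} {α₁ α₂ : Fin 8} (h : StarColoring G A a₁ a₂ c α₁ α₂) :
    StarColoring G A a₂ a₁ c α₂ α₁ :=
  ⟨h.ne₂, h.ne₁, h.ne.symm, h.good, h.free₂, h.free₁⟩

variable [Finite V]

lemma MinCounter.exists_adj_ne (hG : MinCounter V G) {a b : V} (hab : G.Adj a b) :
    ∃ d, d ≠ a ∧ G.Adj b d := by
  by_contra! h
  have hleaf : ∀ d, G.Adj b d → d = a := fun d hd => by_contra fun hne => h d hne hd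
  have hn : s(a, b) ∉ inside G {b}ᶜ := fun h => (mem_inside.1 h).2.2 rfl
  obtain ⟨c, hc⟩ := hG.exists_within {b}ᶜ (e := s(a, b)) hab hn
  have hgood := hc.goodOn_inside (G := G) {b}ᶜ (fun x hx y hy hxy => ⟨hxy, hx, hy⟩)
    fun v _ => hG.1.ncard_eq_of_le (within_le _)
  obtain ⟨T, hT, hTx⟩ := exists_seen_bound c (inside G {b}ᶜ) (G.neighborSet a \ {b})
    fun x _ => card_seen_le_three hG.1 c (inside_subset _) x
  have := hG.1.ncard_diff_le hab
  obtain ⟨t, ht0, ht⟩ := exists_color (T := T) (by omega)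
  have := hgood.extend (inside_subset _) hn ht0 fun x hx hm => by
    rcases hx with ⟨hx, hxb⟩ | ⟨hx, hxa⟩
    · exact ht (hTx x ⟨hx, hxb⟩ hm)
    · exact hxa (hleaf x hx)
  refine hG.not_goodOn (this.mono fun e he => ?_)
  induction e with | _ x y
  have hxy : G.Adj x y := he
  by_cases hx : x = b
  · rw [hx] at hxy ⊢
    rw [hleaf y hxy, Sym2.eq_swap]
    exact Set.mem_insert _ _
  by_cases hy : y = b
  · rw [hy] at hxy ⊢
    rw [hleaf x hxy.symm]
    exact Set.mem_insert _ _
  exact .inr (mem_inside.2 ⟨hxy, hx, hy⟩)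

/-- Color one side of a cut consisting of a single edge. -/
lemma MinCounter.exists_pendant (hG : MinCounter V G) {a b : V} (ha : a ∈ A) (hb : b ∉ A)
    (hab : G.Adj a b) (h : ∀ x ∈ A, ∀ y ∉ A, G.Adj x y → x = a ∧ y = b) :
    ∃ c α, α ≠ 0 ∧ GoodOn G (inside G A) c ∧
      ∀ x ∈ A, x = a ∨ G.Adj a x → α ∉ seen c (inside G A) x := by
  obtain ⟨d, hda, hbd⟩ := hG.exists_adj_ne hab
  have hd : d ∉ insert b A := by
    rintro (rfl | hd)
    · exact hbd.ne rfl
    · exact hda (h d hd b hb hbd.symm).1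
  obtain ⟨c, hc⟩ := hG.exists_within (insert b A) (e := s(b, d)) hbd
    fun h => hd (mem_inside.1 h).2.2
  have hab' : (within G (insert b A)).Adj a b := ⟨hab, .inr ha, .inl rfl⟩
  refine ⟨c, c s(a, b), ?_, ?_, ?_⟩
  · rw [Sym2.eq_swap]
    refine hc.ne_zero hab'.symm ?_
    refine (Set.ncard_le_ncard (t := {a}) ?_).trans (by simp)
    rintro x ⟨hx, -, rfl | hxA⟩
    · exact absurd rfl hx.ne
    · exact (h x hxA b hb hx.symm).1
  · exact hc.goodOn_inside A (fun a ha b hb hab => ⟨hab, .inr ha, .inr hb⟩)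
      fun v _ => hG.1.ncard_eq_of_le (within_le _)
  · intro x hx hxa
    refine hc.notMem_seen ?_ hab' (fun h => hb (mem_inside.1 h).2.2)
      (hxa.imp_right fun h => .inl ⟨h, .inr ha, .inr hx⟩)
    rw [within_edgeSet]
    exact fun e he => ⟨he.1, fun v hv => .inr (he.2 v hv)⟩

lemma card_seen_inside_le (hG : Subcubic G) (c : Sym2 V → Fin 8) {a b : V} (hb : b ∉ A)
    (hab : G.Adj a b) : (seen c (inside G A) a).card ≤ 2 :=
  card_seen_le_two hG c (inside_subset _) hab fun h => absurd (mem_inside.1 h).2.2 hb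

/-- A minimal counterexample has no bridge. -/
lemma MinCounter.not_cut_one (hG : MinCounter V G) {a b : V} (ha : a ∈ A) (hb : b ∉ A)
    (hab : G.Adj a b) (h : ∀ x ∈ A, ∀ y ∉ A, G.Adj x y → x = a ∧ y = b) : False := by
  classical
  obtain ⟨c, α, hα, hc, hcα⟩ := hG.exists_pendant ha hb hab h
  obtain ⟨c', β, hβ, hc', hcβ⟩ := hG.exists_pendant (A := Aᶜ) hb (by simpa) hab.symm
    fun x hx y hy hxy => (h y (by simpa using hy) x hx hxy.symm).symm
  have h1 := card_seen_inside_le hG.1 c hb hab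
  have h2 := card_seen_inside_le (A := Aᶜ) hG.1 c' (by simpa) hab.symm
  obtain ⟨π, hπS, hπ, -⟩ := exists_perm_avoiding (fun k => if k = 0 then 0 else α)
    (S := {0, β}) (F₁ := seen c (inside G A) a) (F₂ := ∅) (G₁ := seen c' (inside G Aᶜ) b)
    (G₂ := ∅) (by
      rintro x hx y hy hxy
      simp only [Finset.coe_insert, Finset.coe_singleton, Set.mem_insert_iff,
        Set.mem_singleton_iff] at hx hy
      grind) (by
      have := hcβ b hb (.inl rfl)
      simp [this, mem_seen]) (by simp)
      (by have := Finset.card_le_two (a := (0 : Fin 8)) (b := β); simp; omega)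
      (by have := Finset.card_le_two (a := (0 : Fin 8)) (b := β); simp; omega)
      (by have := Finset.card_le_two (a := (0 : Fin 8)) (b := β); simp; omega)
  have hπ0 : π 0 = 0 := by simpa using hπS 0 (by simp)
  have hπβ : π β = α := by simpa [hβ] using hπS β (by simp)
  obtain ⟨C, hC, hCA, hCB⟩ := hc.glue (hc'.perm π hπ0) fun x hx y hy hxy => by
    obtain ⟨rfl, rfl⟩ := h x hx y hy hxy
    rw [Finset.disjoint_left]
    intro t ht ht'
    obtain ⟨k, hk, rfl⟩ := (mem_seen_perm hπ0).1 ht'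
    exact hπ k hk ht
  have hE := hC.extend glue_subset (cross_notMem ha hb) hα fun x hx hm => by
    rcases hx with ⟨hx, hxb⟩ | ⟨hx, hxa⟩
    · have hxA : x ∈ A := by_contra fun hxA => hxb (h a ha x hxA hx).2
      exact hcα x hxA (.inr hx) (seen_glue_left hCA hxA hm)
    · have hxA : x ∈ Aᶜ := fun hxA => hxa (h x hxA b hb hx.symm).1
      obtain ⟨k, hk, hkα⟩ := (mem_seen_perm hπ0).1 (seen_glue_right hCB hxA hm)
      rw [π.injective (hkα.trans hπβ.symm)] at hk
      exact hcβ x hxA (.inr hx) hk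
  refine hG.not_goodOn (hE.mono (edge_subset_of_cut (Set.subset_insert _ _) ?_))
  intro x hx y hy hxy
  obtain ⟨rfl, rfl⟩ := h x hx y hy hxy
  exact Set.mem_insert _ _

end SmallCuts

section TwoCuts

variable {V : Type} [Finite V] {G : SimpleGraph V} {A B : Set V} {c c' : Sym2 V → Fin 8}
  {a₁ b₁ a₂ b₂ : V} {α₁ α₂ β₁ β₂ : Fin 8}

lemma MinCounter.exists_star (hG : MinCounter V G) (h : TwoCut G A B a₁ b₁ a₂ b₂) :
    ∃ c α₁ α₂, StarColoring G A a₁ a₂ c α₁ α₂ := by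
  obtain ⟨rfl, ha₁, ha₂, hb₁, hb₂, hane, hbne, h₁, h₂, hcut⟩ := h
  set H : SimpleGraph V := within G A ⊔ edge a₁ b₁ ⊔ edge a₂ b₁ with hH
  have hadj : ∀ x y, H.Adj x y ↔ (G.Adj x y ∧ x ∈ A ∧ y ∈ A) ∨ s(x, y) = s(a₁, b₁) ∨
      s(x, y) = s(a₂, b₁) := by
    intro x y
    rw [hH, sup_adj, sup_adj, edge_adj, edge_adj]
    simp only [within, Sym2.eq_iff]
    have h1 : a₁ ≠ b₁ := h₁.ne
    have h2 : a₂ ≠ b₁ := by rintro rfl; exact hb₁ ha₂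
    grind
  have hA : ∀ {x y}, x ∈ A → y ∈ A → (H.Adj x y ↔ G.Adj x y) := by
    intro x y hx hy
    rw [hadj]
    simp only [Sym2.eq_iff]
    have : b₁ ∉ A := hb₁
    grind
  obtain ⟨d, hda, hbd⟩ := hG.exists_adj_ne h₁
  have hdA : d ∈ Aᶜ := by
    intro hdA
    rcases hcut d hdA b₁ hb₁ hbd.symm with ⟨rfl, -⟩ | ⟨-, rfl⟩
    · exact hda rfl
    · exact hbne rfl
  have hsub : ∀ v, v ∈ A → v ≠ a₂ → H.neighborSet v ⊆ G.neighborSet v := by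
    intro v hv hva x hx
    have hx : H.Adj v x := hx
    rw [hadj] at hx
    simp only [Sym2.eq_iff] at hx
    rcases hx with hx | hx | hx
    · exact hx.1
    · rcases hx with ⟨rfl, rfl⟩ | ⟨rfl, rfl⟩
      · exact h₁
      · exact h₁.symm
    · rcases hx with ⟨rfl, rfl⟩ | ⟨rfl, rfl⟩
      · exact absurd rfl hva
      · exact absurd hv hb₁
  have hsub₂ : H.neighborSet a₂ ⊆ insert b₁ (G.neighborSet a₂ \ {b₂}) := by
    intro x hx
    have hx : H.Adj a₂ x := hx
    rw [hadj] at hx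
    simp only [Sym2.eq_iff] at hx
    rcases hx with hx | hx | hx
    · exact .inr ⟨hx.1, by rintro rfl; exact hb₂ hx.2.2⟩
    · grind
    · grind
  have hcard₂ := hG.1.ncard_diff_le h₂
  have hdeg₁ : (H.neighborSet b₁).ncard ≤ 2 := by
    refine (Set.ncard_le_ncard (t := {a₁, a₂}) ?_).trans (Set.ncard_pair hane).le
    intro x hx
    have hx : H.Adj b₁ x := hx
    rw [hadj] at hx
    simp only [Sym2.eq_iff] at hx
    rcases hx with hx | hx | hx
    · exact absurd hx.2.1 hb₁
    all_goals grind
  have hHG : Subcubic H := by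
    intro v
    by_cases hv : v ∈ A
    · by_cases hva : v = a₂
      · rw [hva]
        have := Set.ncard_le_ncard hsub₂
        have := Set.ncard_insert_le b₁ (G.neighborSet a₂ \ {b₂})
        omega
      · exact (Set.ncard_le_ncard (hsub v hv hva)).trans (hG.1 v)
    · by_cases hvb : v = b₁
      · rw [hvb]
        omega
      · have : H.neighborSet v = ∅ := by
          ext x
          simp only [mem_neighborSet, hadj, Sym2.eq_iff, Set.mem_empty_iff_false]
          grind
        rw [this]
        simp
  have hRcard : ({s(a₁, b₁), s(a₂, b₂), s(b₁, d)} : Set (Sym2 V)).ncard = 3 := by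
    rw [Set.ncard_eq_three]
    refine ⟨_, _, _, ?_, ?_, ?_, rfl⟩ <;> simp only [ne_eq, Sym2.eq_iff] <;> grind
  obtain ⟨c, hc⟩ := hG.exists_good H hHG <| by
    refine edgeSet_ncard_lt (R := {s(a₁, b₁), s(a₂, b₂), s(b₁, d)})
      (S := {s(a₁, b₁), s(a₂, b₁)}) ?_ ?_ ?_
    · rintro e (rfl | rfl | rfl) <;> assumption
    · intro e he
      induction e with | _ x y
      have he : H.Adj x y := he
      rw [hadj] at he
      rcases he with he | he
      · refine .inl ⟨he.1, ?_⟩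
        simp only [Set.mem_insert_iff, Set.mem_singleton_iff, Sym2.eq_iff]
        have : b₁ ∉ A := hb₁
        have : b₂ ∉ A := hb₂
        grind
      · exact .inr he
    · rw [hRcard]
      have := Set.ncard_insert_le s(a₁, b₁) {s(a₂, b₁)}
      rw [Set.ncard_singleton] at this
      omega
  have hHab₁ : H.Adj a₁ b₁ := (hadj _ _).2 (.inr (.inl rfl))
  have hHab₂ : H.Adj a₂ b₁ := (hadj _ _).2 (.inr (.inr rfl))
  have hne₁ := hc.ne_zero hHab₁.symm hdeg₁
  have hne₂ := hc.ne_zero hHab₂.symm hdeg₁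
  rw [Sym2.eq_swap] at hne₁ hne₂
  have hEH : inside G A ⊆ H.edgeSet := by
    intro e he
    induction e with | _ x y
    rw [mem_inside] at he
    exact (hA he.2.1 he.2.2).2 he.1
  refine ⟨c, c s(a₁, b₁), c s(a₂, b₁), hne₁, hne₂, ?_, ?_, ?_, ?_⟩
  · intro h
    exact ((goodColoring_iff c).1 hc).pos s(a₁, b₁) hHab₁ s(a₂, b₁) hHab₂
      (by simp only [ne_eq, Sym2.eq_iff]; grind) h hne₁ ⟨b₁, by simp, b₁, by simp, .inl rfl⟩
  · refine hc.goodOn_inside A (fun x hx y hy => (hA hx hy).2) fun v hv h3 => ?_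
    by_cases hva : v = a₂
    · rw [hva] at h3 ⊢
      have h4 := Set.ncard_le_ncard hsub₂
      have h5 := Set.ncard_insert_le b₁ (G.neighborSet a₂ \ {b₂})
      have h6 := Set.ncard_sdiff_singleton_of_mem (show b₂ ∈ G.neighborSet a₂ from h₂)
      have h7 := hG.1 a₂
      omega
    · have h4 := Set.ncard_le_ncard (hsub v hv hva)
      have h7 := hG.1 v
      omega
  · intro x hx hxa
    exact hc.notMem_seen hEH hHab₁ (fun h => hb₁ (mem_inside.1 h).2.2)
      (by
        rcases hxa with h | rfl | h
        exacts [.inl h, .inr (.inr hHab₂.symm), .inr (.inl ((hA ha₁ hx).2 h))])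
  · intro x hx hxa
    exact hc.notMem_seen hEH hHab₂ (fun h => hb₁ (mem_inside.1 h).2.2)
      (by
        rcases hxa with h | rfl | h
        exacts [.inl h, .inr (.inr hHab₁.symm), .inr (.inl ((hA ha₂ hx).2 h))])

/-- The colorings of the two sides of a cut with two edges do not combine if few colors
occur at one of the ends. -/
lemma MinCounter.star_false (hG : MinCounter V G) (h : TwoCut G A B a₁ b₁ a₂ b₂)
    (hc : StarColoring G A a₁ a₂ c α₁ α₂) (hc' : StarColoring G B b₁ b₂ c' β₁ β₂)
    (hF : (seen c (inside G A) a₁).card ≤ 1) : False := by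
  classical
  obtain ⟨rfl, ha₁, ha₂, hb₁, hb₂, hane, hbne, h₁, h₂, hcut⟩ := h
  have hF₂ := card_seen_inside_le hG.1 c hb₂ h₂
  have hG₁ := card_seen_inside_le (A := Aᶜ) hG.1 c' (by simpa) h₁.symm
  have hG₂ := card_seen_inside_le (A := Aᶜ) hG.1 c' (by simpa) h₂.symm
  set F₁ := seen c (inside G A) a₁ with hF₁_def
  set F₂ := seen c (inside G A) a₂ with hF₂_def
  set G₁ := seen c' (inside G Aᶜ) b₁ with hG₁_def
  set G₂ := seen c' (inside G Aᶜ) b₂ with hG₂_def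
  have hne₁ := hc.ne₁
  have hne₂ := hc.ne₂
  have hne := hc.ne
  have hne₁' := hc'.ne₁
  have hne₂' := hc'.ne₂
  have hne' := hc'.ne
  have hS : ({0, β₁, β₂} : Finset (Fin 8)).card ≤ 3 := Finset.card_le_three
  obtain ⟨π, hπS, hπ₁, hπ₂⟩ := exists_perm_avoiding
    (fun k => if k = 0 then 0 else if k = β₁ then α₁ else α₂)
    (S := {0, β₁, β₂}) (F₁ := F₁) (F₂ := F₂) (G₁ := G₁) (G₂ := G₂) (by
      rintro x hx y hy hxy
      simp only [Finset.coe_insert, Finset.coe_singleton, Set.mem_insert_iff,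
        Set.mem_singleton_iff] at hx hy
      grind) (by
      have h1 := hc'.free₁ b₁ hb₁ (.inl rfl)
      have h2 := hc'.free₂ b₁ hb₁ (.inr (.inl rfl))
      simp [hG₁_def, h1, h2, mem_seen]) (by
      have h1 := hc'.free₁ b₂ hb₂ (.inr (.inl rfl))
      have h2 := hc'.free₂ b₂ hb₂ (.inl rfl)
      simp [hG₂_def, h1, h2, mem_seen])
      (by
        have := Finset.card_union_le F₁ F₂
        have := Finset.card_le_card (Finset.inter_subset_left (s₁ := G₁) (s₂ := G₂))
        omega)
      (by omega)
      (by have := Finset.card_union_le G₁ G₂; omega)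
  have hπ0 : π 0 = 0 := by simpa using hπS 0 (by simp)
  have hπβ₁ : π β₁ = α₁ := by simpa [hne₁'] using hπS β₁ (by simp)
  have hπβ₂ : π β₂ = α₂ := by simpa [hne₂', hne'.symm] using hπS β₂ (by simp)
  obtain ⟨C, hC, hCA, hCB⟩ := hc.good.glue (hc'.good.perm π hπ0) fun x hx y hy hxy => by
    rw [Finset.disjoint_left]
    intro t ht ht'
    obtain ⟨k, hk, rfl⟩ := (mem_seen_perm hπ0).1 ht'
    rcases hcut x hx y hy hxy with ⟨rfl, rfl⟩ | ⟨rfl, rfl⟩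
    · exact hπ₁ k hk ht
    · exact hπ₂ k hk ht
  have hE₁ := hC.extend glue_subset (cross_notMem ha₁ hb₁) hne₁ fun x hx hm => by
    rcases hx with ⟨hx, hxb⟩ | ⟨hx, hxa⟩
    · have hxA : x ∈ A := by_contra fun hxA => by
        have := hcut a₁ ha₁ x hxA hx
        grind
      exact hc.free₁ x hxA (.inr (.inr hx)) (seen_glue_left hCA hxA hm)
    · have hxA : x ∈ Aᶜ := fun hxA => by
        have := hcut x hxA b₁ hb₁ hx.symm
        grind
      obtain ⟨k, hk, hkα⟩ := (mem_seen_perm hπ0).1 (seen_glue_right hCB hxA hm)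
      rw [π.injective (hkα.trans hπβ₁.symm)] at hk
      exact hc'.free₁ x hxA (.inr (.inr hx)) hk
  have hE₂ := hE₁.extend (Set.insert_subset h₁ glue_subset) (a := a₂) (b := b₂) (t := α₂) (by
      rintro (h | h)
      · simp only [Sym2.eq_iff] at h
        grind
      · exact cross_notMem ha₂ hb₂ h) hne₂ fun x hx hm => by
    have hm := (Finset.mem_insert.1 (seen_update_subset x hm)).resolve_left hne.symm
    rcases hx with ⟨hx, hxb⟩ | ⟨hx, hxa⟩
    · have hxA : x ∈ A := by_contra fun hxA => by
        have := hcut a₂ ha₂ x hxA hx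
        grind
      exact hc.free₂ x hxA (.inr (.inr hx)) (seen_glue_left hCA hxA hm)
    · have hxA : x ∈ Aᶜ := fun hxA => by
        have := hcut x hxA b₂ hb₂ hx.symm
        grind
      obtain ⟨k, hk, hkα⟩ := (mem_seen_perm hπ0).1 (seen_glue_right hCB hxA hm)
      rw [π.injective (hkα.trans hπβ₂.symm)] at hk
      exact hc'.free₂ x hxA (.inr (.inr hx)) hk
  refine hG.not_goodOn (hE₂.mono (edge_subset_of_cut
    ((Set.subset_insert _ _).trans (Set.subset_insert _ _)) ?_))
  intro x hx y hy hxy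
  rcases hcut x hx y hy hxy with ⟨rfl, rfl⟩ | ⟨rfl, rfl⟩ <;> simp

lemma ncard_of_two_le_card_seen (hG : Subcubic G) {a b : V} (hb : b ∉ A) (hab : G.Adj a b)
    (h : 2 ≤ (seen c (inside G A) a).card) :
    (G.neighborSet a).ncard = 3 ∧ ∀ f ∈ inside G A, a ∈ f → c f ≠ 0 := by
  have hle : (seen c (inside G A) a).card ≤ (G.neighborSet a \ {b}).ncard :=
    card_seen_le_ncard c (inside_subset _) a {b}ᶜ fun y hy => by
      rintro rfl
      exact hb (mem_inside.1 hy).2.2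
  have h1 := Set.ncard_sdiff_singleton_of_mem (show b ∈ G.neighborSet a from hab)
  refine ⟨by have := hG a; omega, fun f hf haf h0 => ?_⟩
  obtain ⟨z, rfl⟩ := Sym2.mem_iff_exists.1 haf
  have hz := mem_inside.1 hf
  have hbz : b ≠ z := by
    rintro rfl
    exact hb hz.2.2
  have hsub : seen c (inside G A) a ⊆ seen c (inside G A \ {s(a, z)}) a := by
    intro t ht
    obtain ⟨ht0, f, hf, hx, rfl⟩ := mem_seen.1 ht
    exact mem_seen.2 ⟨ht0, f, ⟨hf, by rintro rfl; exact ht0 h0⟩, hx, rfl⟩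
  have h2 := Finset.card_le_card hsub
  have h3 : (seen c (inside G A \ {s(a, z)}) a).card ≤ (G.neighborSet a \ {b, z}).ncard :=
    card_seen_le_ncard c (Set.sdiff_subset.trans (inside_subset _)) a {b, z}ᶜ fun y hy => by
      rintro (rfl | rfl)
      · exact hb (mem_inside.1 hy.1).2.2
      · exact hy.2 rfl
  have h4 := hG.ncard_diff_pair_le hab hz.1 hbz
  omega

/-- A minimal counterexample has no cut consisting of two disjoint edges. -/
lemma MinCounter.not_twoCut (hG : MinCounter V G) (h : TwoCut G A B a₁ b₁ a₂ b₂) : False := by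
  classical
  obtain ⟨c, α₁, α₂, hc⟩ := hG.exists_star h
  obtain ⟨c', β₁, β₂, hc'⟩ := hG.exists_star h.symm
  by_cases hF₁ : (seen c (inside G A) a₁).card ≤ 1
  · exact hG.star_false h hc hc' hF₁
  by_cases hF₂ : (seen c (inside G A) a₂).card ≤ 1
  · exact hG.star_false h.swap hc.swap hc'.swap hF₂
  by_cases hG₁ : (seen c' (inside G B) b₁).card ≤ 1
  · exact hG.star_false h.symm hc' hc hG₁
  by_cases hG₂ : (seen c' (inside G B) b₂).card ≤ 1
  · exact hG.star_false h.symm.swap hc'.swap hc.swap hG₂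
  obtain ⟨rfl, ha₁, ha₂, hb₁, hb₂, hane, hbne, h₁, h₂, hcut⟩ := h
  have hA₁ := ncard_of_two_le_card_seen hG.1 hb₁ h₁ (not_le.1 hF₁)
  have hA₂ := ncard_of_two_le_card_seen hG.1 hb₂ h₂ (not_le.1 hF₂)
  have hB₁ := ncard_of_two_le_card_seen (A := Aᶜ) hG.1 (by simpa) h₁.symm (not_le.1 hG₁)
  have hB₂ := ncard_of_two_le_card_seen (A := Aᶜ) hG.1 (by simpa) h₂.symm (not_le.1 hG₂)
  have hF₁' := card_seen_inside_le hG.1 c hb₁ h₁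
  have hF₂' := card_seen_inside_le hG.1 c hb₂ h₂
  have hG₁' := card_seen_inside_le (A := Aᶜ) hG.1 c' (by simpa) h₁.symm
  have hG₂' := card_seen_inside_le (A := Aᶜ) hG.1 c' (by simpa) h₂.symm
  set F₁ := seen c (inside G A) a₁
  set F₂ := seen c (inside G A) a₂
  set G₁ := seen c' (inside G Aᶜ) b₁ with hG₁_def
  set G₂ := seen c' (inside G Aᶜ) b₂ with hG₂_def
  obtain ⟨π, hπS, hπ₁, hπ₂⟩ := exists_perm_avoiding id
    (S := {0}) (F₁ := F₁) (F₂ := F₂) (G₁ := G₁) (G₂ := G₂) Function.injective_id.injOn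
      (by simp [hG₁_def, mem_seen]) (by simp [hG₂_def, mem_seen])
      (by
        have := Finset.card_union_le F₁ F₂
        have := Finset.card_le_card (Finset.inter_subset_left (s₁ := G₁) (s₂ := G₂))
        rw [Finset.card_singleton]
        omega)
      (by rw [Finset.card_singleton]; omega)
      (by have := Finset.card_union_le G₁ G₂; rw [Finset.card_singleton]; omega)
  have hπ0 : π 0 = 0 := by simpa using hπS 0 (by simp)
  obtain ⟨C, hC, hCA, hCB⟩ := hc.good.glue (hc'.good.perm π hπ0) fun x hx y hy hxy => by
    rw [Finset.disjoint_left]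
    intro t ht ht'
    obtain ⟨k, hk, rfl⟩ := (mem_seen_perm hπ0).1 ht'
    rcases hcut x hx y hy hxy with ⟨rfl, rfl⟩ | ⟨rfl, rfl⟩
    · exact hπ₁ k hk ht
    · exact hπ₂ k hk ht
  have hfree : ∀ a ∈ A, ∀ b ∈ Aᶜ, (∀ f ∈ inside G A, a ∈ f → c f ≠ 0) →
      (∀ f ∈ inside G Aᶜ, b ∈ f → c' f ≠ 0) →
      ∀ f ∈ inside G A ∪ inside G Aᶜ, a ∈ f ∨ b ∈ f → C f ≠ 0 := by
    rintro a ha b hb hca hcb f (hf | hf) (h | h)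
    · rw [hCA f hf]
      exact hca f hf h
    · exact absurd (hf.2 b h) hb
    · exact absurd ha (hf.2 a h)
    · rw [hCB f hf]
      intro h0
      exact hcb f hf h (π.injective (h0.trans hπ0.symm))
  have hE₁ := hC.extend_zero (cross_notMem ha₁ hb₁) hA₁.1 hB₁.1
    (hfree a₁ ha₁ b₁ hb₁ hA₁.2 hB₁.2)
  have hE₂ := hE₁.extend_zero (a := a₂) (b := b₂) (by
      rintro (h | h)
      · simp only [Sym2.eq_iff] at h
        grind
      · exact cross_notMem ha₂ hb₂ h) hA₂.1 hB₂.1 (by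
    rintro f (rfl | hf) hf'
    · simp only [Sym2.mem_iff] at hf'
      grind
    · rw [Function.update_of_ne (by rintro rfl; exact cross_notMem ha₁ hb₁ hf)]
      exact hfree a₂ ha₂ b₂ hb₂ hA₂.2 hB₂.2 f hf hf')
  refine hG.not_goodOn (hE₂.mono (edge_subset_of_cut
    ((Set.subset_insert _ _).trans (Set.subset_insert _ _)) ?_))
  intro x hx y hy hxy
  rcases hcut x hx y hy hxy with ⟨rfl, rfl⟩ | ⟨rfl, rfl⟩ <;> simp

end TwoCuts

section DegreeTwo

variable {V : Type} {G : SimpleGraph V} {c : Sym2 V → Fin 8}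

lemma seen_inside_of_notMem {W : Set V} {x : V} (hx : x ∉ W) (t : Fin 8) :
    t ∉ seen c (inside G W) x := by
  intro h
  obtain ⟨-, f, hf, hxf, -⟩ := mem_seen.1 h
  exact hx (hf.2 x hxf)

lemma exists_two_colors {S T : Finset (Fin 8)} (hS : S.card ≤ 6) (hT : T.card ≤ 6)
    (h : S.card = 6 → S ≠ T) :
    ∃ s t, s ≠ 0 ∧ t ≠ 0 ∧ s ≠ t ∧ s ∉ S ∧ t ∉ T := by
  by_cases hS5 : S.card ≤ 5
  · obtain ⟨t, ht0, ht⟩ := exists_color hT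
    obtain ⟨s, hs0, hs⟩ := exists_color (T := insert t S)
      ((Finset.card_insert_le _ _).trans (by omega))
    grind
  by_cases hT5 : T.card ≤ 5
  · obtain ⟨s, hs0, hs⟩ := exists_color hS
    obtain ⟨t, ht0, ht⟩ := exists_color (T := insert s T)
      ((Finset.card_insert_le _ _).trans (by omega))
    grind
  have hne := h (by omega)
  obtain ⟨s, hs0, hs⟩ := exists_color hS
  by_cases hsT : s ∈ T
  · obtain ⟨t, ht0, ht⟩ := exists_color hT
    refine ⟨s, t, hs0, ht0, ?_, hs, ht⟩
    rintro rfl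
    exact ht hsT
  obtain ⟨t, htS, htT⟩ : ∃ t, t ∈ S ∧ t ∉ T := by
    by_contra! hsub
    exact hne (Finset.eq_of_subset_of_card_le hsub (by omega))
  by_cases ht0 : t = 0
  · obtain ⟨r, hrT, hrS⟩ : ∃ t, t ∈ T ∧ t ∉ S := by
      by_contra! hsub
      exact hne (Finset.eq_of_subset_of_card_le hsub (by omega)).symm
    refine ⟨r, s, ?_, hs0, ?_, hrS, hsT⟩
    · rintro rfl
      exact hrS (ht0 ▸ htS)
    · rintro rfl
      exact hsT hrT
  · refine ⟨s, t, hs0, ht0, ?_, hs, htT⟩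
    rintro rfl
    exact hs htS

variable [Finite V]

set_option maxHeartbeats 1000000 in
/-- Extend a coloring to the edges at a vertex `u` with two neighbors `v`, `v₂` of degree
two. -/
lemma GoodOn.extend_spider (hG : Subcubic G) {u v v₂ u₁ w w₂ : V}
    (hu : ∀ x, G.Adj u x ↔ x = v ∨ x = v₂ ∨ x = u₁) (hv : ∀ x, G.Adj v x ↔ x = u ∨ x = w)
    (hv₂ : ∀ x, G.Adj v₂ x ↔ x = u ∨ x = w₂) (hvv : v ≠ v₂) (hvu : u₁ ≠ v) (hvu₂ : u₁ ≠ v₂)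
    (hw : w ≠ v₂) (hwu : w ≠ u) (hwu₂ : w₂ ≠ u)
    (hc : GoodOn G (inside G {u, v, v₂}ᶜ) c)
    (hfree : ∀ f ∈ inside G {u, v, v₂}ᶜ, u₁ ∈ f → c f ≠ 0)
    (hP : (seen c (inside G {u, v, v₂}ᶜ) w ∩ seen c (inside G {u, v, v₂}ᶜ) w₂).card ≤ 1) :
    ∃ C, GoodOn G G.edgeSet C := by
  classical
  set E₀ := inside G {u, v, v₂}ᶜ with hE₀
  set P := seen c E₀ w with hPdef
  set P₂ := seen c E₀ w₂ with hP₂def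
  have auv : G.Adj u v := by simp [hu]
  have auv₂ : G.Adj u v₂ := by simp [hu]
  have auu₁ : G.Adj u u₁ := by simp [hu]
  have avw : G.Adj v w := by simp [hv]
  have avw₂ : G.Adj v₂ w₂ := by simp [hv₂]
  have hw₂ : w₂ ≠ v := by
    rintro rfl
    have := (hv v₂).1 avw₂.symm
    have := auv₂.ne
    grind
  have hE₀n : ∀ {x y}, (x = u ∨ x = v ∨ x = v₂) → s(x, y) ∉ E₀ := by
    rintro x y hx h
    exact (mem_inside.1 h).2.1 hx
  have hx₀ : ∀ {x}, (x = u ∨ x = v ∨ x = v₂) → ∀ t, t ∉ seen c E₀ x := fun hx =>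
    seen_inside_of_notMem fun h => h hx
  have hPc : P.card ≤ 2 := card_seen_le_two hG c (inside_subset _) avw.symm fun h =>
    absurd (by simp) (mem_inside.1 h).2.2
  have hPc₂ : P₂.card ≤ 2 := card_seen_le_two hG c (inside_subset _) avw₂.symm fun h =>
    absurd (by simp) (mem_inside.1 h).2.2
  -- the edge `vw`
  obtain ⟨T, hT, hTx⟩ := exists_seen_bound c E₀ (G.neighborSet w \ {v})
    fun x _ => card_seen_le_three hG c (inside_subset _) x
  have := hG.ncard_diff_le avw.symm
  obtain ⟨a, ha0, haT⟩ := exists_color (T := T) (by omega)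
  have g₁ := hc.extend (inside_subset _) (a := v) (b := w) (hE₀n (by simp)) ha0
    fun x hx hm => by
      rcases hx with ⟨hx, hxw⟩ | ⟨hx, hxv⟩
      · exact hx₀ (by grind) _ hm
      · exact haT (hTx x ⟨hx, hxv⟩ hm)
  set E₁ := insert s(v, w) E₀ with hE₁
  set c₁ := Function.update c s(v, w) a
  have hE₁G : E₁ ⊆ G.edgeSet := Set.insert_subset avw (inside_subset _)
  have hs₁ : ∀ x, seen c₁ E₁ x ⊆ insert a (seen c E₀ x) := seen_update_subset
  have hs₁' : ∀ x, x ≠ v → x ≠ w → seen c₁ E₁ x ⊆ seen c E₀ x := fun x h h' =>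
    seen_update_of_notMem (by simp [h, h'])
  -- the edge `v₂w₂`
  obtain ⟨T₂, hT₂, hTx₂⟩ := exists_seen_bound c₁ E₁ (G.neighborSet w₂ \ {v₂})
    fun x _ => card_seen_le_three hG c₁ hE₁G x
  have := hG.ncard_diff_le avw₂.symm
  obtain ⟨d, hd0, hdT⟩ := exists_color (T := T₂) (by omega)
  have g₂ := g₁.extend hE₁G (a := v₂) (b := w₂) (by
      rintro (h | h)
      · simp only [Sym2.eq_iff] at h
        grind
      · exact hE₀n (by simp) h) hd0
    fun x hx hm => by
      rcases hx with ⟨hx, hxw⟩ | ⟨hx, hxv⟩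
      · have hxu : x = u := ((hv₂ x).1 hx).resolve_right hxw
        rw [hxu] at hm
        exact hx₀ (.inl rfl) _ (hs₁' u auv.ne hwu.symm hm)
      · exact hdT (hTx₂ x ⟨hx, hxv⟩ hm)
  set E₂ := insert s(v₂, w₂) E₁ with hE₂
  set c₂ := Function.update c₁ s(v₂, w₂) d
  have hE₂G : E₂ ⊆ G.edgeSet := Set.insert_subset avw₂ hE₁G
  have hs₂ : ∀ x, seen c₂ E₂ x ⊆ insert d (seen c₁ E₁ x) := seen_update_subset
  have hs₂' : ∀ x, x ≠ v₂ → x ≠ w₂ → seen c₂ E₂ x ⊆ seen c₁ E₁ x := fun x h h' =>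
    seen_update_of_notMem (by simp [h, h'])
  have hs₂u : ∀ t, t ∉ seen c₂ E₂ u := fun t h =>
    hx₀ (.inl rfl) t (hs₁' u auv.ne hwu.symm (hs₂' u auv₂.ne hwu₂.symm h))
  have hs₂v : seen c₂ E₂ v ⊆ {a} := fun t h => by
    have := hs₁ v (hs₂' v hvv hw₂.symm h)
    have := hx₀ (x := v) (by simp) t
    grind
  have hs₂v₂ : seen c₂ E₂ v₂ ⊆ {d} := fun t h => by
    have := hs₂ v₂ h
    have h2 := @hs₁' v₂ hvv.symm hw.symm t
    have := hx₀ (x := v₂) (by simp) t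
    grind
  -- the edge `uu₁`
  have hn₃ : s(u, u₁) ∉ E₂ := by
    rintro (h | h | h)
    · simp only [Sym2.eq_iff] at h
      grind
    · simp only [Sym2.eq_iff] at h
      have := auv.ne
      grind
    · exact hE₀n (by simp) h
  obtain ⟨e, g₃, hQ⟩ : ∃ e, GoodOn G (insert s(u, u₁) E₂) (Function.update c₂ s(u, u₁) e) ∧
      (seen (Function.update c₂ s(u, u₁) e) (insert s(u, u₁) E₂) u₁).card ≤ 2 := by
    by_cases hu₁ : (G.neighborSet u₁).ncard = 3
    · refine ⟨0, g₂.extend_zero hn₃ ?_ hu₁ ?_, ?_⟩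
      · rw [show G.neighborSet u = {v, v₂, u₁} from Set.ext hu]
        exact Set.ncard_eq_three.2 ⟨_, _, _, hvv, hvu.symm, hvu₂.symm, rfl⟩
      · rintro f hf hf'
        have h2 : f = s(v₂, w₂) → c₂ f = d := by
          rintro rfl
          exact Function.update_self _ _ _
        have h1 : f ≠ s(v₂, w₂) → c₂ f = c₁ f := fun h => Function.update_of_ne h _ _
        have h1' : f = s(v, w) → c₁ f = a := by
          rintro rfl
          exact Function.update_self _ _ _
        have h0 : f ≠ s(v, w) → c₁ f = c f := fun h => Function.update_of_ne h _ _
        have h3 : f ∈ E₀ → u ∉ f := fun hf hu => hf.2 u hu (by simp)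
        have h4 := hfree f
        simp only [hE₂, hE₁, Set.mem_insert_iff] at hf
        grind
      · exact card_seen_le_two hG _ (Set.insert_subset auu₁ hE₂G) auu₁.symm fun _ => by
          rw [Sym2.eq_swap]
          exact Function.update_self _ _ _
    · have hdeg : (G.neighborSet u₁).ncard ≤ 2 := by
        have := hG u₁
        omega
      have h1 := Set.ncard_sdiff_singleton_of_mem (show u ∈ G.neighborSet u₁ from auu₁.symm)
      obtain ⟨T₃, hT₃, hTx₃⟩ := exists_seen_bound c₂ E₂ (G.neighborSet u₁ \ {u})
        fun x _ => card_seen_le_three hG c₂ hE₂G x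
      have hcard : (insert a (insert d T₃)).card ≤ 6 := by
        have := Finset.card_insert_le a (insert d T₃)
        have := Finset.card_insert_le d T₃
        omega
      obtain ⟨e, he0, heT⟩ := exists_color hcard
      refine ⟨e, g₂.extend hE₂G hn₃ he0 fun x hx hm => ?_, ?_⟩
      · rcases hx with ⟨hx, hxu⟩ | ⟨hx, hxu⟩
        · rcases (hu x).1 hx with rfl | rfl | rfl
          · have := hs₂v hm
            grind
          · have := hs₂v₂ hm
            grind
          · exact hxu rfl
        · have := hTx₃ x ⟨hx, hxu⟩ hm
          grind
      · refine (card_seen_le_ncard _ (Set.insert_subset auu₁ hE₂G) u₁ Set.univ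
          fun _ _ => trivial).trans ?_
        rwa [Set.inter_univ]
  set E₃ := insert s(u, u₁) E₂ with hE₃
  set c₃ := Function.update c₂ s(u, u₁) e
  set Q := seen c₃ E₃ u₁ with hQdef
  have hE₃G : E₃ ⊆ G.edgeSet := Set.insert_subset auu₁ hE₂G
  have hs₃' : ∀ x, x ≠ u → x ≠ u₁ → seen c₃ E₃ x ⊆ seen c₂ E₂ x := fun x h h' =>
    seen_update_of_notMem (by simp [h, h'])
  set S := P ∪ {a, d} ∪ Q with hS
  set S₂ := P₂ ∪ {a, d} ∪ Q with hS₂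
  have had : ({a, d} : Finset (Fin 8)).card ≤ 2 := Finset.card_le_two
  have hscard : S.card ≤ P.card + 2 + 2 := by
    have := Finset.card_union_le (P ∪ {a, d}) Q
    have := Finset.card_union_le P {a, d}
    rw [hS]
    omega
  have hscard₂ : S₂.card ≤ P₂.card + 2 + 2 := by
    have := Finset.card_union_le (P₂ ∪ {a, d}) Q
    have := Finset.card_union_le P₂ {a, d}
    rw [hS₂]
    omega
  obtain ⟨b, t, hb0, ht0, hbt, hbS, htS⟩ := exists_two_colors (S := S) (T := S₂)
    (by omega) (by omega) fun h6 h => by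
      have hdis : Disjoint P ({a, d} ∪ Q) := by
        rw [← Finset.card_union_eq_card_add_card]
        have := Finset.card_union_le P ({a, d} ∪ Q)
        have := Finset.card_union_le {a, d} Q
        rw [hS, Finset.union_assoc] at h6
        omega
      have hsub : P ⊆ P ∩ P₂ := by
        intro k hk
        have : k ∈ S₂ := by rw [← h]; grind
        rw [Finset.disjoint_left] at hdis
        have := hdis hk
        grind
      have := Finset.card_le_card hsub
      omega
  have hwS : ∀ t ∈ seen c₃ E₃ w, t ∈ S := by
    intro t ht
    by_cases hwu₁ : w = u₁
    · rw [hwu₁] at ht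
      grind
    have h2 := hs₁ w
    have h3 := hs₂ w (hs₃' w hwu hwu₁ ht)
    grind
  have hwS₂ : ∀ t ∈ seen c₃ E₃ w₂, t ∈ S₂ := by
    intro t ht
    by_cases hwu₁ : w₂ = u₁
    · rw [hwu₁] at ht
      grind
    have h2 := hs₁ w₂
    have h3 := hs₂ w₂ (hs₃' w₂ hwu₂ hwu₁ ht)
    grind
  -- the edge `vu`
  have hn₄ : s(v, u) ∉ E₃ := by
    simp only [hE₃, hE₂, hE₁, Set.mem_insert_iff, Sym2.eq_iff]
    have := hE₀n (x := v) (y := u) (by simp)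
    grind
  have g₄ := g₃.extend hE₃G hn₄ hb0 fun x hx hm => hbS <| by
    rcases hx with ⟨hx, hxu⟩ | ⟨hx, hxu⟩
    · have hxw : x = w := ((hv x).1 hx).resolve_left hxu
      exact hwS b (hxw ▸ hm)
    · rcases (hu x).1 hx with h | h | h
      · exact absurd h hxu
      · rw [h] at hm
        have := hs₂v₂ (hs₃' v₂ auv₂.ne' hvu₂.symm hm)
        grind
      · rw [h] at hm
        grind
  set E₄ := insert s(v, u) E₃ with hE₄
  set c₄ := Function.update c₃ s(v, u) b
  have hE₄G : E₄ ⊆ G.edgeSet := Set.insert_subset auv.symm hE₃G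
  have hs₄ : ∀ x, seen c₄ E₄ x ⊆ insert b (seen c₃ E₃ x) := seen_update_subset
  have hs₄' : ∀ x, x ≠ v → x ≠ u → seen c₄ E₄ x ⊆ seen c₃ E₃ x := fun x h h' =>
    seen_update_of_notMem (by simp [h, h'])
  -- the edge `v₂u`
  have hn₅ : s(v₂, u) ∉ E₄ := by
    simp only [hE₄, hE₃, hE₂, hE₁, Set.mem_insert_iff, Sym2.eq_iff]
    have := hE₀n (x := v₂) (y := u) (by simp)
    grind
  have g₅ := g₄.extend hE₄G hn₅ ht0 fun x hx hm => by
    rcases hx with ⟨hx, hxu⟩ | ⟨hx, hxu⟩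
    · have hxw : x = w₂ := ((hv₂ x).1 hx).resolve_left hxu
      rw [hxw] at hm
      exact htS (hwS₂ t (hs₄' w₂ hw₂ hwu₂ hm))
    · rcases (hu x).1 hx with h | h | h
      · rw [h] at hm
        have h1 := hs₄ v hm
        have h2 := @hs₃' v auv.ne' hvu.symm t
        have h3 := @hs₂v t
        grind
      · exact absurd h hxu
      · rw [h] at hm
        have := hs₄' u₁ hvu auu₁.ne' hm
        grind
  refine ⟨_, g₅.mono fun f hf => ?_⟩
  have key : ∀ x y, G.Adj x y → x = u ∨ x = v ∨ x = v₂ → s(x, y) ∈ insert s(v₂, u) E₄ := by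
    intro x y hxy hx
    simp only [hE₄, hE₃, hE₂, hE₁, Set.mem_insert_iff, Sym2.eq_iff]
    rcases hx with rfl | rfl | rfl
    · rcases (hu y).1 hxy with h | h | h <;> simp [h]
    · rcases (hv y).1 hxy with h | h <;> simp [h]
    · rcases (hv₂ y).1 hxy with h | h <;> simp [h]
  induction f with | _ x y
  have hxy : G.Adj x y := hf
  by_cases hx : x = u ∨ x = v ∨ x = v₂
  · exact key x y hxy hx
  by_cases hy : y = u ∨ y = v ∨ y = v₂
  · rw [Sym2.eq_swap (a := x) (b := y)]
    exact key y x hxy.symm hy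
  · exact .inr (.inr (.inr (.inr (.inr (mem_inside.2 ⟨hxy, by simpa using hx, by simpa using hy⟩)))))

end DegreeTwo

section CubicNeighbors

variable {V : Type} {G : SimpleGraph V} [Finite V]

/-- A degree three vertex of a minimal counterexample has at most one neighbor of degree
two. -/
lemma MinCounter.not_two_degree_two (hG : MinCounter V G) {u v v₂ : V}
    (hu3 : (G.neighborSet u).ncard = 3) (auv : G.Adj u v) (auv₂ : G.Adj u v₂) (hvv : v ≠ v₂)
    (hv2 : (G.neighborSet v).ncard = 2) (hv₂2 : (G.neighborSet v₂).ncard = 2) : False := by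
  classical
  obtain ⟨u₁, hu₁⟩ : ∃ u₁, G.neighborSet u \ {v, v₂} = {u₁} := by
    rw [← Set.ncard_eq_one]
    have hsub : ({v, v₂} : Set V) ⊆ G.neighborSet u := by
      rintro x (rfl | rfl) <;> assumption
    rw [Set.ncard_sdiff hsub, Set.ncard_pair hvv, hu3]
  have other : ∀ {x}, G.Adj u x → (G.neighborSet x).ncard = 2 →
      ∃ w, G.neighborSet x \ {u} = {w} := by
    intro x hx h2
    rw [← Set.ncard_eq_one, Set.ncard_sdiff_singleton_of_mem (show u ∈ G.neighborSet x from hx.symm),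
      h2]
  obtain ⟨w, hw⟩ := other auv hv2
  obtain ⟨w₂, hw₂⟩ := other auv₂ hv₂2
  simp only [Set.ext_iff, Set.mem_sdiff, mem_neighborSet, Set.mem_insert_iff,
    Set.mem_singleton_iff] at hu₁ hw hw₂
  have hu : ∀ x, G.Adj u x ↔ x = v ∨ x = v₂ ∨ x = u₁ := by grind
  have hv : ∀ x, G.Adj v x ↔ x = u ∨ x = w := by
    have := auv.symm
    grind
  have hv₂ : ∀ x, G.Adj v₂ x ↔ x = u ∨ x = w₂ := by
    have := auv₂.symm
    grind
  have huu₁ := (hu₁ u₁).2 rfl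
  have hvw := (hw w).2 rfl
  have hvw₂ := (hw₂ w₂).2 rfl
  have nuv := auv.ne
  have nuv₂ := auv₂.ne
  have nuu₁ := huu₁.1.ne
  have nvw := hvw.1.ne
  have nvw₂ := hvw₂.1.ne
  by_cases hwv₂ : w = v₂
  · have hw₂v : w₂ = v := by
      have := (hv₂ v).1 (hwv₂ ▸ hvw.1.symm)
      grind
    refine hG.not_cut_one (A := {u, v, v₂}) (a := u) (b := u₁) (by simp) (by simp; grind)
      huu₁.1 ?_
    rintro x (rfl | rfl | rfl) y hy hxy
    · rcases (hu y).1 hxy with rfl | rfl | rfl <;> simp at hy ⊢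
    · rcases (hv y).1 hxy with rfl | rfl <;> simp [hwv₂] at hy ⊢
    · rcases (hv₂ y).1 hxy with rfl | rfl <;> simp [hw₂v] at hy ⊢
  have hw₂v : w₂ ≠ v := by
    rintro rfl
    have := (hv v₂).1 hvw₂.1.symm
    grind
  set S : Set V := {u, v, v₂} with hS
  have hSc : ∀ x, x ∈ Sᶜ ↔ x ≠ u ∧ x ≠ v ∧ x ≠ v₂ := by
    intro x
    simp [hS]
  set H : SimpleGraph V := within G Sᶜ ⊔ edge w w₂ with hH
  have hadj : ∀ x y, H.Adj x y ↔ (G.Adj x y ∧ x ∈ Sᶜ ∧ y ∈ Sᶜ) ∨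
      (s(x, y) = s(w, w₂) ∧ w ≠ w₂) := by
    intro x y
    rw [hH, sup_adj, edge_adj]
    simp only [within, Sym2.eq_iff]
    grind
  have hsub : ∀ x, x ≠ w → x ≠ w₂ → H.neighborSet x ⊆ G.neighborSet x \ {u} := by
    intro x hx hx₂ y hy
    have hy : H.Adj x y := hy
    rw [hadj, Sym2.eq_iff, hSc, hSc] at hy
    refine ⟨?_, ?_⟩
    · rw [mem_neighborSet]
      grind
    · rw [Set.mem_singleton_iff]
      grind
  have hsubw : H.neighborSet w ⊆ insert w₂ (G.neighborSet w \ {v, u}) := by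
    intro y hy
    have hy : H.Adj w y := hy
    rw [hadj, Sym2.eq_iff, hSc, hSc] at hy
    simp only [Set.mem_insert_iff, Set.mem_sdiff, Set.mem_singleton_iff, mem_neighborSet]
    grind
  have hsubw₂ : H.neighborSet w₂ ⊆ insert w (G.neighborSet w₂ \ {v₂, u}) := by
    intro y hy
    have hy : H.Adj w₂ y := hy
    rw [hadj, Sym2.eq_iff, hSc, hSc] at hy
    simp only [Set.mem_insert_iff, Set.mem_sdiff, Set.mem_singleton_iff, mem_neighborSet]
    grind
  have hle : ∀ x, (H.neighborSet x).ncard ≤ (G.neighborSet x).ncard := by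
    intro x
    by_cases hx : x = w
    · rw [hx]
      have h1 := Set.ncard_le_ncard hsubw
      have h2 := Set.ncard_insert_le w₂ (G.neighborSet w \ {v, u})
      have h3 : (G.neighborSet w \ {v, u}).ncard ≤ (G.neighborSet w \ {v}).ncard :=
        Set.ncard_le_ncard fun y hy => ⟨hy.1, fun h => hy.2 (.inl h)⟩
      have h4 := Set.ncard_sdiff_singleton_add_one (show v ∈ G.neighborSet w from hvw.1.symm)
      omega
    by_cases hx₂ : x = w₂
    · rw [hx₂]
      have h1 := Set.ncard_le_ncard hsubw₂
      have h2 := Set.ncard_insert_le w (G.neighborSet w₂ \ {v₂, u})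
      have h3 : (G.neighborSet w₂ \ {v₂, u}).ncard ≤ (G.neighborSet w₂ \ {v₂}).ncard :=
        Set.ncard_le_ncard fun y hy => ⟨hy.1, fun h => hy.2 (.inl h)⟩
      have h4 := Set.ncard_sdiff_singleton_add_one (show v₂ ∈ G.neighborSet w₂ from hvw₂.1.symm)
      omega
    exact Set.ncard_le_ncard ((hsub x hx hx₂).trans Set.sdiff_subset)
  have hdeg : (H.neighborSet u₁).ncard ≤ 2 := by
    by_cases hx : u₁ = w
    · rw [hx]
      have h1 := Set.ncard_le_ncard hsubw
      have h2 := Set.ncard_insert_le w₂ (G.neighborSet w \ {v, u})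
      have h3 := hG.1.ncard_diff_pair_le hvw.1.symm (hx ▸ huu₁.1.symm) nuv.symm
      omega
    by_cases hx₂ : u₁ = w₂
    · rw [hx₂]
      have h1 := Set.ncard_le_ncard hsubw₂
      have h2 := Set.ncard_insert_le w (G.neighborSet w₂ \ {v₂, u})
      have h3 := hG.1.ncard_diff_pair_le hvw₂.1.symm (hx₂ ▸ huu₁.1.symm) nuv₂.symm
      omega
    exact (Set.ncard_le_ncard (hsub u₁ hx hx₂)).trans (hG.1.ncard_diff_le huu₁.1.symm)
  obtain ⟨c, hc⟩ := hG.exists_good H (fun x => (hle x).trans (hG.1 x)) <| by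
    refine edgeSet_ncard_lt (R := {s(v, w), s(v, u)}) (S := {s(w, w₂)}) ?_ ?_ ?_
    · rintro e (rfl | rfl)
      · exact hvw.1
      · exact auv.symm
    · intro e he
      induction e with | _ x y
      have he : H.Adj x y := he
      rw [hadj] at he
      rcases he with he | he
      · refine .inl ⟨he.1, ?_⟩
        rw [hSc, hSc] at he
        simp only [Set.mem_insert_iff, Set.mem_singleton_iff, Sym2.eq_iff]
        grind
      · exact .inr he.1
    · rw [Set.ncard_singleton, Set.ncard_pair]
      · omega
      · simp only [ne_eq, Sym2.eq_iff]
        grind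
  have hHS : ∀ x ∈ Sᶜ, ∀ y ∈ Sᶜ, G.Adj x y → H.Adj x y := fun x hx y hy hxy =>
    (hadj x y).2 (.inl ⟨hxy, hx, hy⟩)
  have hEH : ∀ e ∈ inside G Sᶜ, e ∈ H.edgeSet := by
    intro e he
    induction e with | _ x y
    rw [mem_inside] at he
    exact hHS x he.2.1 y he.2.2 he.1
  have hgood := hc.goodOn_inside Sᶜ hHS fun x _ h3 => by
    have := hle x
    have := hG.1 x
    omega
  obtain ⟨C, hC⟩ := hgood.extend_spider hG.1 hu hv hv₂ hvv (by grind) (by grind) hwv₂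
    (by grind) (by grind) (fun f hf hfu => by
      obtain ⟨y, rfl⟩ := Sym2.mem_iff_exists.1 hfu
      exact hc.ne_zero (hEH _ hf) hdeg) (by
      by_cases hww : w = w₂
      · rw [← hww, Finset.inter_self]
        refine (card_seen_le_ncard c (inside_subset _) w {v, v₂}ᶜ ?_).trans
          (hG.1.ncard_diff_pair_le hvw.1.symm (hww ▸ hvw₂.1.symm) hvv)
        rintro y hy (rfl | rfl)
        · exact (mem_inside.1 hy).2.2 (by simp)
        · exact (mem_inside.1 hy).2.2 (by simp)
      · rw [Finset.card_le_one_iff_subset_singleton]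
        refine ⟨c s(w, w₂), fun k hk => ?_⟩
        obtain ⟨h1, h2⟩ := Finset.mem_inter.1 hk
        obtain ⟨h0, f, hf, hwf, rfl⟩ := mem_seen.1 h1
        obtain ⟨-, g, hg, hwg, hgc⟩ := mem_seen.1 h2
        rw [Finset.mem_singleton]
        have hHww : H.Adj w w₂ := (hadj w w₂).2 (.inr ⟨rfl, hww⟩)
        by_cases hfg : f = g
        · rw [hfg] at hwf ⊢
          rw [(Sym2.mem_and_mem_iff hww).1 ⟨hwf, hwg⟩]
        · exact absurd ⟨w, hwf, w₂, hwg, .inr hHww⟩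
            (((goodColoring_iff c).1 hc).pos f (hEH f hf) g (hEH g hg) hfg hgc.symm h0))
  exact hG.not_goodOn hC

end CubicNeighbors

section Tutte

variable {V : Type} {G : SimpleGraph V} [Finite V]

open Classical in
/-- An odd set of cubic vertices of a minimal counterexample sends out at least three
edges. -/
lemma MinCounter.three_le_cut (hG : MinCounter V G) {A : Set V}
    (hA : ∀ a ∈ A, (G.neighborSet a).ncard = 3) (hodd : Odd A.ncard) :
    3 ≤ {p : V × V | p.1 ∈ A ∧ p.2 ∉ A ∧ G.Adj p.1 p.2}.ncard := by
  have : Fintype V := Fintype.ofFinite V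
  set P : Finset (V × V) := {p | p.1 ∈ A ∧ p.2 ∉ A ∧ G.Adj p.1 p.2} with hP
  have hPc : {p : V × V | p.1 ∈ A ∧ p.2 ∉ A ∧ G.Adj p.1 p.2}.ncard = P.card := by
    rw [← Set.ncard_coe_finset]
    simp [hP]
  rw [hPc]
  have hsum : P.card = ∑ a ∈ A.toFinset, (Finset.univ.filter fun b => b ∉ A ∧ G.Adj a b).card := by
    rw [← Finset.card_sigma]
    refine Finset.card_bij (fun p _ => ⟨p.1, p.2⟩) ?_ ?_ ?_
    · rintro ⟨a, b⟩ h
      simpa [hP] using h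
    · rintro ⟨a, b⟩ - ⟨a', b'⟩ - h
      simpa using h
    · rintro ⟨a, b⟩ h
      exact ⟨(a, b), by simpa [hP] using h, rfl⟩
  have hw : ∀ a b, (within G A).Adj a b ↔ G.Adj a b ∧ a ∈ A ∧ b ∈ A := fun _ _ => Iff.rfl
  have hdeg : ∀ a ∈ A.toFinset,
      (within G A).degree a + (Finset.univ.filter fun b => b ∉ A ∧ G.Adj a b).card = 3 := by
    intro a ha
    rw [Set.mem_toFinset] at ha
    rw [← hA a ha, ← card_neighborFinset_eq_degree, ← Finset.card_union_of_disjoint, ← Set.ncard_coe_finset]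
    · congr 1
      ext b
      simp only [mem_neighborFinset, Finset.mem_filter, Finset.mem_univ, hw, true_and,
        Finset.coe_union, Set.mem_union, Finset.mem_coe, mem_neighborSet]
      tauto
    · rw [Finset.disjoint_left]
      intro b hb hb'
      simp only [mem_neighborFinset, Finset.mem_filter, hw] at hb hb'
      exact hb'.2.1 hb.2.2
  have hhand := (within G A).sum_degrees_eq_twice_card_edges
  have hsub : ∑ a ∈ A.toFinset, (within G A).degree a = ∑ a, (within G A).degree a := by
    refine Finset.sum_subset (Finset.subset_univ _) fun a _ ha => ?_
    rw [Set.mem_toFinset] at ha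
    rw [← card_neighborFinset_eq_degree, Finset.card_eq_zero]
    ext b
    simp only [mem_neighborFinset, hw, Finset.notMem_empty, iff_false]
    exact fun h => ha h.2.1
  have htot := Finset.sum_congr rfl hdeg
  rw [Finset.sum_add_distrib, hsub, hhand, ← hsum, Finset.sum_const, smul_eq_mul,
    ← Set.ncard_eq_toFinset_card'] at htot
  obtain ⟨k, hk⟩ := hodd
  have hne : P.card ≠ 1 := by
    intro h1
    obtain ⟨⟨a, b⟩, hab⟩ := Finset.card_eq_one.1 h1
    have hm : ∀ x y, (x ∈ A ∧ y ∉ A ∧ G.Adj x y) ↔ x = a ∧ y = b := by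
      intro x y
      have := Finset.ext_iff.1 hab (x, y)
      simpa [hP] using this
    have h := (hm a b).2 ⟨rfl, rfl⟩
    exact hG.not_cut_one h.1 h.2.1 h.2.2 fun x hx y hy hxy => (hm x y).1 ⟨hx, hy, hxy⟩
  omega

/-- Two copies of `G` in which the vertices over `D` form a clique. -/
def double (G : SimpleGraph V) (D : Set V) : SimpleGraph (V × Bool) where
  Adj p q := (p.2 = q.2 ∧ G.Adj p.1 q.1) ∨ (p.1 ∈ D ∧ q.1 ∈ D ∧ p ≠ q)
  symm := ⟨fun _ _ h => h.imp (fun h => ⟨h.1.symm, h.2.symm⟩) fun h => ⟨h.2.1, h.1, h.2.2.symm⟩⟩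
  loopless := ⟨fun _ h => h.elim (fun h => h.2.ne rfl) fun h => h.2.2 rfl⟩

open Classical in
lemma MinCounter.not_isTutteViolator (hG : MinCounter V G) {D : Set V}
    (hD : ∀ a ∉ D, (G.neighborSet a).ncard = 3) (u : Set (V × Bool)) :
    ¬(double G D).IsTutteViolator u := by
  have : Fintype V := Fintype.ofFinite V
  unfold IsTutteViolator
  set K := ((⊤ : (double G D).Subgraph).deleteVerts u).coe with hK
  have hadj : ∀ p q (hp : p ∈ ((⊤ : (double G D).Subgraph).deleteVerts u).verts)
      (hq : q ∈ ((⊤ : (double G D).Subgraph).deleteVerts u).verts),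
      (double G D).Adj p q → K.Adj ⟨p, hp⟩ ⟨q, hq⟩ := by
    intro p q hp hq h
    rw [hK, Subgraph.coe_adj, Subgraph.deleteVerts_adj]
    simp only [Subgraph.deleteVerts_verts, Subgraph.verts_top, Set.mem_sdiff] at hp hq
    exact ⟨hp.1, hp.2, hq.1, hq.2, h⟩
  have hpar : Odd K.oddComponents.ncard ↔ Odd u.ncard := by
    rw [odd_ncard_oddComponents]
    have h1 := Set.ncard_add_ncard_compl u
    have h2 : Nat.card ((⊤ : (double G D).Subgraph).deleteVerts u).verts = uᶜ.ncard := by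
      rw [Nat.card_coe_set_eq]
      congr 1
      ext
      simp
    rw [h2]
    rw [Nat.card_prod, Nat.card_eq_fintype_card (α := Bool), Fintype.card_bool] at h1
    rw [Nat.odd_iff, Nat.odd_iff]
    omega
  set R : Finset ((V × Bool) × (V × Bool)) :=
    {r | r.1 ∉ u ∧ r.2 ∈ u ∧ r.1.2 = r.2.2 ∧ G.Adj r.1.1 r.2.1} with hR
  have hRcard : R.card ≤ u.ncard * 3 := by
    rw [Set.ncard_eq_toFinset_card']
    refine (Finset.card_le_card (t := u.toFinset.biUnion fun w =>
      (G.neighborFinset w.1).image fun a => ((a, w.2), w)) ?_).trans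
      (Finset.card_biUnion_le_card_mul _ _ _ fun w _ => ?_)
    · rintro ⟨⟨a, i⟩, ⟨b, j⟩⟩ h
      simp only [hR, Finset.mem_filter] at h
      simp only [Finset.mem_biUnion, Set.mem_toFinset, Finset.mem_image, mem_neighborFinset]
      obtain ⟨-, -, h2, rfl, h4⟩ := h
      exact ⟨_, h2, a, h4.symm, rfl⟩
    · refine Finset.card_image_le.trans ?_
      rw [← Set.ncard_coe_finset, coe_neighborFinset]
      exact hG.1 _
  set Q : Finset K.ConnectedComponent :=
    {c | Odd c.supp.ncard ∧ ∀ p ∈ c.supp, p.1.1 ∉ D} with hQ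
  have hQcard : Q.card * 3 ≤ R.card * 1 := by
    refine Finset.card_mul_le_card_mul (fun c r => ∃ p ∈ c.supp, p.1 = r.1) ?_ ?_
    · intro c hc
      simp only [hQ, Finset.mem_filter, Finset.mem_univ, true_and] at hc
      set A : Bool → Set V := fun i => {a | ∃ p ∈ c.supp, p.1 = (a, i)} with hA
      have hsum : c.supp.ncard = (A true).ncard + (A false).ncard := by
        have h1 : Subtype.val '' c.supp = (fun a => (a, true)) '' A true ∪ (fun a => (a, false)) '' A false := by
          ext ⟨a, i⟩
          cases i <;> simp [hA]
        rw [← Set.ncard_image_of_injective _ Subtype.val_injective, h1, Set.ncard_union_eq,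
          Set.ncard_image_of_injective, Set.ncard_image_of_injective]
        · exact fun a b h => (Prod.mk.inj h).1
        · exact fun a b h => (Prod.mk.inj h).1
        · rw [Set.disjoint_left]
          rintro _ ⟨a, -, rfl⟩ ⟨b, -, h⟩
          simp at h
      obtain ⟨i, hi⟩ : ∃ i, Odd (A i).ncard := by
        by_contra! h
        have h1 := h true
        have h2 := h false
        rw [Nat.not_odd_iff_even] at h1 h2
        exact Nat.not_odd_iff_even.2 (h1.add h2) (hsum ▸ hc.1)
      have hA3 : ∀ a ∈ A i, (G.neighborSet a).ncard = 3 := by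
        rintro a ⟨p, hp, hpa⟩
        have := hc.2 p hp
        rw [hpa] at this
        exact hD a this
      refine (hG.three_le_cut hA3 hi).trans ?_
      rw [← Set.ncard_coe_finset]
      refine Set.ncard_le_ncard_of_injOn (fun p => ((p.1, i), (p.2, i))) ?_ ?_
      · rintro ⟨a, b⟩ ⟨⟨p, hp, hpa⟩, hb, hab⟩
        have hau : (a, i) ∉ u := by
          rw [← hpa]
          exact (Set.mem_sdiff _).1 p.2 |>.2
        have hbu : (b, i) ∈ u := by
          by_contra hbu
          have hbv : (b, i) ∈ ((⊤ : (double G D).Subgraph).deleteVerts u).verts := by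
            simpa using hbu
          refine hb ⟨⟨(b, i), hbv⟩, ?_, rfl⟩
          refine c.mem_supp_of_adj_mem_supp hp ?_
          refine hadj _ _ p.2 hbv ?_
          rw [hpa]
          exact .inl ⟨rfl, hab⟩
        simp only [Finset.coe_bipartiteAbove, Set.mem_ofPred_eq, hR, Finset.mem_filter,
          Finset.mem_univ, true_and]
        exact ⟨⟨hau, hbu, hab⟩, p, hp, hpa⟩
      · rintro ⟨a, b⟩ - ⟨a', b'⟩ - h
        simpa using h
    · intro r hr
      rw [Finset.card_le_one]
      intro c hc c' hc'
      simp only [Finset.mem_bipartiteBelow] at hc hc'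
      obtain ⟨-, p, hp, hpr⟩ := hc
      obtain ⟨-, p', hp', hpr'⟩ := hc'
      have : p = p' := Subtype.ext (hpr.trans hpr'.symm)
      rw [this] at hp
      exact ConnectedComponent.eq_of_common_vertex hp hp'
  have hone : (K.oddComponents \ (Q : Set K.ConnectedComponent)).ncard ≤ 1 := by
    rw [Set.ncard_le_one]
    rintro c ⟨hc, hcQ⟩ c' ⟨hc', hcQ'⟩
    have hex : ∀ c : K.ConnectedComponent, c ∈ K.oddComponents → c ∉ (Q : Set K.ConnectedComponent) →
        ∃ p ∈ c.supp, p.1.1 ∈ D := by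
      intro c hc hcQ
      by_contra! h
      exact hcQ (Finset.mem_coe.2 (Finset.mem_filter.2 ⟨Finset.mem_univ _, hc, h⟩))
    obtain ⟨p, hp, hpD⟩ := hex c hc hcQ
    obtain ⟨q, hq, hqD⟩ := hex c' hc' hcQ'
    by_cases hpq : p = q
    · rw [hpq] at hp
      exact ConnectedComponent.eq_of_common_vertex hp hq
    · exact ConnectedComponent.eq_of_common_vertex
        (c.mem_supp_of_adj_mem_supp hp (hadj _ _ p.2 q.2 (.inr ⟨hpD, hqD, fun h => hpq (Subtype.ext h)⟩))) hq
  have hle := Set.ncard_le_ncard_sdiff_add_ncard K.oddComponents (Q : Set K.ConnectedComponent)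
  rw [Set.ncard_coe_finset] at hle
  rw [Nat.odd_iff, Nat.odd_iff] at hpar
  change ¬ u.ncard < K.oddComponents.ncard
  omega

/-- The vertices outside a set containing all vertices of degree two can be matched. -/
lemma MinCounter.exists_partner (hG : MinCounter V G) {D : Set V}
    (hD : ∀ a ∉ D, (G.neighborSet a).ncard = 3) :
    ∃ f : V → V, ∀ x ∉ D, G.Adj x (f x) ∧ f (f x) = x := by
  obtain ⟨M, hM⟩ := tutte.2 (hG.not_isTutteViolator hD)
  rw [Subgraph.isPerfectMatching_iff] at hM
  choose g hg hu using hM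
  refine ⟨fun x => (g (x, false)).1, fun x hx => ?_⟩
  have hgx := hg (x, false)
  have h : (g (x, false)).2 = false ∧ G.Adj x (g (x, false)).1 := by
    rcases hgx.adj_sub with h | h
    · exact ⟨h.1.symm, h.2⟩
    · exact absurd h.1 hx
  refine ⟨h.2, ?_⟩
  have h1 : ((g (x, false)).1, false) = g (x, false) := Prod.ext rfl h.1.symm
  change (g ((g (x, false)).1, false)).1 = x
  rw [h1, ← hu _ _ hgx.symm]

end Tutte

section Cubic

variable {V : Type} {G : SimpleGraph V} [Finite V]

/-- The neighbors of `x` reached by edges outside `M` of rank at most `n`. -/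
def lower (G : SimpleGraph V) (M : Set (Sym2 V)) (r : Sym2 V → ℕ) (n : ℕ) (x : V) : Set V :=
  {y | G.Adj x y ∧ s(x, y) ∉ M ∧ r s(x, y) ≤ n}

lemma ncard_lower_le_two {M : Set (Sym2 V)} {r : Sym2 V → ℕ} {n : ℕ} {x y : V}
    (hG : Subcubic G) (hxy : G.Adj x y) (h : s(x, y) ∈ M ∨ n < r s(x, y)) :
    (lower G M r n x).ncard ≤ 2 := by
  refine (Set.ncard_le_ncard ?_).trans (hG.ncard_diff_le hxy)
  rintro z ⟨hz, hzM, hzr⟩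
  refine ⟨hz, ?_⟩
  rintro rfl
  rcases h with h | h
  · exact hzM h
  · omega

/-- Color the edges outside a matching greedily in the order of increasing rank. -/
lemma exists_greedy {M : Set (Sym2 V)} (hM : M ⊆ G.edgeSet)
    (hMm : ∀ e ∈ M, ∀ f ∈ M, e ≠ f → ∀ v ∈ e, v ∉ f)
    (hM3 : ∀ e ∈ M, ∀ v ∈ e, (G.neighborSet v).ncard = 3) (r : Sym2 V → ℕ)
    (hr : ∀ e ∈ G.edgeSet, e ∉ M → ∃ a b, e = s(a, b) ∧ ∃ N : Set V, N.ncard ≤ 3 ∧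
      ∀ x, (G.Adj a x ∧ x ≠ b) ∨ (G.Adj b x ∧ x ≠ a) →
        lower G M r (r e) x = ∅ ∨ x ∈ N ∧ (lower G M r (r e) x).ncard ≤ 2) :
    ∃ c, GoodOn G G.edgeSet c := by
  classical
  have key : ∀ S : Finset (Sym2 V), ∃ c, GoodOn G (M ∪ (S ∩ G.edgeSet)) c ∧ ∀ e ∈ M, c e = 0 := by
    intro S
    refine Finset.induction_on_max_value r S ?_ fun e S heS hmax ih => ?_
    · refine ⟨fun _ => 0, ?_, fun _ _ => rfl⟩
      simp only [Finset.coe_empty, Set.empty_inter, Set.union_empty]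
      exact ⟨fun e he f hf hne _ _ => hMm e he f hf hne, fun _ _ _ _ _ _ h => absurd rfl h,
        fun e he _ => hM3 e he⟩
    · obtain ⟨c, hc, hcM⟩ := ih
      by_cases heM : e ∈ M
      · refine ⟨c, hc.mono ?_, hcM⟩
        rintro f (hf | ⟨hf, hfG⟩)
        · exact .inl hf
        · rcases Finset.mem_insert.1 (Finset.mem_coe.1 hf) with rfl | hf
          · exact .inl heM
          · exact .inr ⟨hf, hfG⟩
      by_cases heG : e ∉ G.edgeSet
      · refine ⟨c, hc.mono ?_, hcM⟩
        rintro f (hf | ⟨hf, hfG⟩)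
        · exact .inl hf
        · rcases Finset.mem_insert.1 (Finset.mem_coe.1 hf) with rfl | hf
          · exact absurd hfG heG
          · exact .inr ⟨hf, hfG⟩
      rw [not_not] at heG
      obtain ⟨a, b, rfl, N, hN, hx⟩ := hr e heG heM
      set E := M ∪ ((S : Set (Sym2 V)) ∩ G.edgeSet) with hE
      have hEG : E ⊆ G.edgeSet := Set.union_subset hM Set.inter_subset_right
      have hne : s(a, b) ∉ E := by
        rintro (h | h)
        · exact heM h
        · exact heS h.1
      have hcard : ∀ x, (seen c E x).card ≤ (lower G M r (r s(a, b)) x).ncard := by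
        intro x
        have hsub : seen c E x ⊆ seen c ((S ∩ G.edgeSet) \ M) x := by
          intro t ht
          obtain ⟨h0, f, hf, hxf, rfl⟩ := mem_seen.1 ht
          have hfM : f ∉ M := fun h => h0 (hcM f h)
          exact mem_seen.2 ⟨h0, f, ⟨hf.resolve_left hfM, hfM⟩, hxf, rfl⟩
        refine (Finset.card_le_card hsub).trans <| (card_seen_le_ncard c
          (Set.sdiff_subset.trans Set.inter_subset_right) x (lower G M r (r s(a, b)) x) ?_).trans
          (Set.ncard_le_ncard Set.inter_subset_right)
        rintro y ⟨⟨hyS, hyG⟩, hyM⟩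
        exact ⟨hyG, hyM, hmax _ hyS⟩
      obtain ⟨T, hT, hTN⟩ := exists_seen_bound c E
        (N ∩ {x | (lower G M r (r s(a, b)) x).ncard ≤ 2}) fun x hx => (hcard x).trans hx.2
      obtain ⟨t, ht0, htT⟩ := exists_color (T := T) <| by
        have := Set.ncard_le_ncard (Set.inter_subset_left (s := N)
          (t := {x | (lower G M r (r s(a, b)) x).ncard ≤ 2}))
        omega
      refine ⟨_, (hc.extend hEG hne ht0 fun x hxa ht => ?_).mono ?_, ?_⟩
      · rcases hx x hxa with h | h
        · have := hcard x
          rw [h, Set.ncard_empty, Nat.le_zero, Finset.card_eq_zero] at this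
          simp [this] at ht
        · exact htT (hTN x h ht)
      · rintro f (hf | ⟨hf, hfG⟩)
        · exact .inr (.inl hf)
        · rcases Finset.mem_insert.1 (Finset.mem_coe.1 hf) with rfl | hf
          · exact .inl rfl
          · exact .inr (.inr ⟨hf, hfG⟩)
      · intro f hf
        rw [Function.update_of_ne (by rintro rfl; exact heM hf)]
        exact hcM f hf
  have := Fintype.ofFinite (Sym2 V)
  obtain ⟨c, hc, -⟩ := key Finset.univ
  exact ⟨c, hc.mono fun e he => .inr ⟨by simp, he⟩⟩

lemma MinCounter.exists_depth (hG : MinCounter V G) (v : V) :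
    ∃ (d : V → ℕ) (n : ℕ), (∀ x, d x ≤ n) ∧ ∀ x, x ≠ v → ∃ p, G.Adj x p ∧ d p < d x := by
  have hreach : ∀ x, G.Reachable x v := by
    by_contra! h
    obtain ⟨x, hx⟩ := h
    obtain ⟨a, ha, b, hb, hab⟩ := hG.exists_cut (A := {x | G.Reachable x v}) ⟨v, .refl v⟩ ⟨x, hx⟩
    exact hb (hab.symm.reachable.trans ha)
  obtain ⟨n, hn⟩ := (Set.finite_range fun x => G.dist x v).bddAbove
  refine ⟨fun x => G.dist x v, n, fun x => hn ⟨x, rfl⟩, fun x hx => ?_⟩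
  obtain ⟨p, hp⟩ := (hreach x).exists_walk_length_eq_dist
  cases p with
  | nil => exact absurd rfl hx
  | cons h q =>
    refine ⟨_, h, ?_⟩
    rw [Walk.length_cons] at hp
    exact (dist_le q).trans_lt (Nat.lt_of_lt_of_eq q.length.lt_succ_self hp)

lemma MinCounter.two_le (hG : MinCounter V G) (v : V) : 2 ≤ (G.neighborSet v).ncard := by
  obtain ⟨a, ha⟩ := hG.exists_adj v
  obtain ⟨d, hd, hvd⟩ := hG.exists_adj_ne ha.symm
  rw [← Set.ncard_pair hd]
  exact Set.ncard_le_ncard (by rintro x (rfl | rfl) <;> assumption)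

/-- A matching between cubic vertices that leaves an independent set of cubic vertices
uncovered, each of them with its own neighbor of degree two. -/
lemma MinCounter.exists_matching (hG : MinCounter V G) {D : Set V}
    (hD : ∀ a, a ∈ D ↔ (G.neighborSet a).ncard ≠ 3) :
    ∃ M ⊆ G.edgeSet, ∃ U : Set V, (∀ e ∈ M, ∀ f ∈ M, e ≠ f → ∀ v ∈ e, v ∉ f) ∧
      (∀ e ∈ M, ∀ v ∈ e, v ∉ D) ∧ (∀ x ∈ U, x ∉ D) ∧
      (∀ x ∉ D, x ∈ U ∨ ∃ y, G.Adj x y ∧ s(x, y) ∈ M) ∧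
      (∀ x ∈ U, ∃ y ∈ D, G.Adj x y) ∧ (∀ x ∈ U, ∀ y ∈ U, ¬G.Adj x y) ∧
      ∀ x ∈ U, ∀ y ∈ U, x ≠ y → ∀ z ∈ D, G.Adj x z → ¬G.Adj y z := by
  obtain ⟨f, hf⟩ := hG.exists_partner (D := D) fun a ha => not_not.1 fun h => ha ((hD a).2 h)
  set P : Set (Sym2 V) → Prop := fun M => M ⊆ G.edgeSet ∧
    (∀ e ∈ M, ∀ f ∈ M, e ≠ f → ∀ v ∈ e, v ∉ f) ∧ ∀ e ∈ M, ∀ v ∈ e, v ∉ D with hP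
  set M₀ : Set (Sym2 V) := {e | ∃ x, x ∉ D ∧ f x ∉ D ∧ e = s(x, f x)} with hM₀
  have hPM₀ : P M₀ := by
    refine ⟨?_, ?_, ?_⟩
    · rintro _ ⟨x, hx, -, rfl⟩
      exact (hf x hx).1
    · rintro _ ⟨x, hx, hfx, rfl⟩ _ ⟨y, hy, hfy, rfl⟩ hne v hv hv'
      have h1 := (hf x hx).2
      have h2 := (hf y hy).2
      simp only [Sym2.mem_iff] at hv hv'
      rw [ne_eq, Sym2.eq_iff] at hne
      grind
    · rintro _ ⟨x, hx, hfx, rfl⟩ v hv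
      rcases Sym2.mem_iff.1 hv with rfl | rfl <;> assumption
  obtain ⟨M, hle, hmax⟩ := Finite.exists_le_maximal hPM₀
  set U : Set V := {x | x ∉ D ∧ ∀ e ∈ M, x ∉ e} with hU
  have hUf : ∀ x ∈ U, f x ∈ D := by
    rintro x ⟨hx, hxM⟩
    by_contra hfx
    exact hxM _ (hle ⟨x, hx, hfx, rfl⟩) (Sym2.mem_mk_left _ _)
  refine ⟨M, hmax.prop.1, U, hmax.prop.2.1, hmax.prop.2.2, fun x hx => hx.1, ?_, ?_, ?_, ?_⟩
  · intro x hx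
    by_cases hxM : ∀ e ∈ M, x ∉ e
    · exact .inl ⟨hx, hxM⟩
    · push Not at hxM
      obtain ⟨e, he, hxe⟩ := hxM
      obtain ⟨y, rfl⟩ := Sym2.mem_iff_exists.1 hxe
      exact .inr ⟨y, hmax.prop.1 he, he⟩
  · exact fun x hx => ⟨f x, hUf x hx, (hf x hx.1).1⟩
  · intro x hx y hy hxy
    have hP' : P (insert s(x, y) M) := by
      refine ⟨Set.insert_subset hxy hmax.prop.1, ?_, ?_⟩
      · have h1 := hmax.prop.2.1
        have h2 : ∀ e ∈ M, ∀ v ∈ s(x, y), v ∉ e := by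
          intro e he v hv
          rcases Sym2.mem_iff.1 hv with rfl | rfl
          · exact hx.2 e he
          · exact hy.2 e he
        rintro e (rfl | he) g (rfl | hg) hne v hv hv'
        · exact hne rfl
        · exact h2 g hg v hv hv'
        · exact h2 e he v hv' hv
        · exact h1 e he g hg hne v hv hv'
      · rintro e (rfl | he) v hv
        · rcases Sym2.mem_iff.1 hv with rfl | rfl
          · exact hx.1
          · exact hy.1
        · exact hmax.prop.2.2 e he v hv
    exact hx.2 _ (hmax.2 hP' (Set.subset_insert _ _) (.inl rfl)) (Sym2.mem_mk_left _ _)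
  · have huniq : ∀ x ∈ U, ∀ z ∈ D, G.Adj x z → f x = z := by
      intro x hx z hz hxz
      by_contra hne
      have hdeg : ∀ y ∈ D, (G.neighborSet y).ncard = 2 := by
        intro y hy
        have := (hD y).1 hy
        have := hG.1 y
        have := hG.two_le y
        omega
      exact hG.not_two_degree_two (not_not.1 fun h => hx.1 ((hD x).2 h)) (hf x hx.1).1 hxz hne
        (hdeg _ (hUf x hx)) (hdeg z hz)
    intro x hx y hy hxy z hz hxz hyz
    have h1 := huniq x hx z hz hxz
    have h2 := huniq y hy z hz hyz
    exact hxy (by rw [← (hf x hx.1).2, ← (hf y hy.1).2, h1, h2])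

open Classical in
/-- A minimal counterexample is cubic. -/
lemma MinCounter.cubic (hG : MinCounter V G) (v : V) : (G.neighborSet v).ncard = 3 := by
  by_contra hv
  set D : Set V := {a | (G.neighborSet a).ncard ≠ 3} with hD
  obtain ⟨M, hM, U, hMm, hMD, hUn, hcov, hUD, hUU, hUz⟩ := hG.exists_matching (D := D) fun _ => Iff.rfl
  obtain ⟨d, n, hdn, hp⟩ := hG.exists_depth v
  have hD2 : ∀ x ∈ D, (G.neighborSet x).ncard ≤ 2 := by
    intro x hx
    have := hG.1 x
    have : (G.neighborSet x).ncard ≠ 3 := hx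
    omega
  set r : Sym2 V → ℕ := fun e =>
    if ∃ x ∈ e, x ∈ D then if ∃ x ∈ e, x ∈ U then n + 2 else n + 1 else n - (e.map d).inf with hr
  have hr1 : ∀ {x y}, x ∉ D → y ∉ D → r s(x, y) = n - min (d x) (d y) := by
    intro x y hx hy
    simp [hr, hx, hy]
  have hrD : ∀ {x y}, x ∈ D ∨ y ∈ D → n < r s(x, y) := by
    intro x y h
    have : ∃ z ∈ s(x, y), z ∈ D := by simpa using h
    simp only [hr, if_pos this]
    split_ifs <;> omega
  have hrU : ∀ {x y}, x ∈ U → y ∈ D → r s(x, y) = n + 2 := by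
    intro x y hx hy
    simp [hr, hx, hy]
  have hrU' : ∀ {x y}, n + 1 < r s(x, y) → x ∈ U ∨ y ∈ U := by
    intro x y h
    by_contra! hne
    have : ¬∃ z ∈ s(x, y), z ∈ U := by simpa using hne
    simp only [hr, if_neg this] at h
    split_ifs at h <;> omega
  have hlow : ∀ k x, x ∉ U ∨ k ≤ n + 1 → (lower G M r k x).ncard ≤ 2 := by
    intro k x hx
    by_cases hxD : x ∈ D
    · exact (Set.ncard_le_ncard fun y hy => hy.1).trans (hD2 x hxD)
    rcases hcov x hxD with hxU | ⟨y, hxy, hyM⟩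
    · obtain ⟨y, hy, hxy⟩ := hUD x hxU
      refine ncard_lower_le_two hG.1 hxy (.inr ?_)
      rw [hrU hxU hy]
      have := hx.resolve_left (not_not.2 hxU)
      omega
    · exact ncard_lower_le_two hG.1 hxy (.inl hyM)
  refine hG.not_goodOn (exists_greedy hM hMm (fun e he x hx => not_not.1 (hMD e he x hx)) r
    fun e he heM => ?_).choose_spec
  have hsplit : (∃ a b, e = s(a, b) ∧ a ∈ D) ∨ ∃ a b, e = s(a, b) ∧ a ∉ D ∧ b ∉ D ∧ d a ≤ d b := by
    induction e with | _ a b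
    by_cases ha : a ∈ D
    · exact .inl ⟨a, b, rfl, ha⟩
    by_cases hb : b ∈ D
    · exact .inl ⟨b, a, Sym2.eq_swap, hb⟩
    rcases le_total (d a) (d b) with h | h
    · exact .inr ⟨a, b, rfl, ha, hb, h⟩
    · exact .inr ⟨b, a, Sym2.eq_swap, hb, ha, h⟩
  obtain ⟨a, b, rfl, ha⟩ | ⟨a, b, rfl, ha, hb, hab⟩ := hsplit
  · have hab : G.Adj a b := he
    refine ⟨a, b, rfl, (G.neighborSet a \ {b}) ∪ (G.neighborSet b \ {a}), ?_, ?_⟩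
    · have h1 := Set.ncard_union_le (G.neighborSet a \ {b}) (G.neighborSet b \ {a})
      have h2 := hG.1.ncard_diff_le hab.symm
      have h3 := Set.ncard_sdiff_singleton_of_mem (show b ∈ G.neighborSet a from hab)
      have := hD2 a ha
      omega
    · intro x hx
      refine .inr ⟨hx, hlow _ _ ?_⟩
      by_contra! h
      obtain ⟨hxU, hlt⟩ := h
      rcases hrU' hlt with haU | hbU
      · exact hUn a haU ha
      · rcases hx with ⟨hax, hxb⟩ | ⟨hbx, hxa⟩
        · exact hUz x hxU b hbU hxb a ha hax.symm hab.symm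
        · exact hUU b hbU x hxU hbx
  · have hAb : G.Adj a b := he
    obtain ⟨p, hap, hpd⟩ := hp a (by rintro rfl; exact ha hv)
    have hpb : p ≠ b := by
      rintro rfl
      omega
    refine ⟨a, b, rfl, (G.neighborSet a \ {b, p}) ∪ (G.neighborSet b \ {a}), ?_, ?_⟩
    · have h1 := Set.ncard_union_le (G.neighborSet a \ {b, p}) (G.neighborSet b \ {a})
      have h2 := hG.1.ncard_diff_le hAb.symm
      have h3 := hG.1.ncard_diff_pair_le hAb hap hpb.symm
      omega
    · intro x hx
      by_cases hxp : x = p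
      · left
        rw [Set.eq_empty_iff_forall_notMem]
        rintro y ⟨hy, -, hyr⟩
        rw [hr1 ha hb, hxp] at hyr
        by_cases hpy : p ∈ D ∨ y ∈ D
        · have := hrD hpy
          omega
        · push Not at hpy
          rw [hr1 hpy.1 hpy.2] at hyr
          have := hdn a
          omega
      · refine .inr ⟨?_, hlow _ _ (.inr ?_)⟩
        · simp only [Set.mem_union, Set.mem_sdiff, mem_neighborSet, Set.mem_insert_iff,
            Set.mem_singleton_iff]
          tauto
        · rw [hr1 ha hb]
          omega

end Cubic

section ThreeCuts

variable {V : Type} {G : SimpleGraph V} {A : Set V} {x y : Fin 3 → V}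

/-- A cut with exactly the three disjoint edges `x i`, `y i`. -/
structure ThreeCut (G : SimpleGraph V) (A : Set V) (x y : Fin 3 → V) : Prop where
  mem_x : ∀ i, x i ∈ A
  mem_y : ∀ i, y i ∉ A
  adj : ∀ i, G.Adj (x i) (y i)
  inj_x : Function.Injective x
  inj_y : Function.Injective y
  cut : ∀ a ∈ A, ∀ b ∉ A, G.Adj a b → ∃ i, a = x i ∧ b = y i

variable [Finite V]

open Classical in
/-- Colorings of the two sides of a cut combine by giving color `0` to the edges of the
cut. -/
lemma ThreeCut.false_of_colorings (h : ThreeCut G A x y) (hG : MinCounter V G)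
    {c c' : Sym2 V → Fin 8} (hc : GoodOn G (inside G A) c) (hc' : GoodOn G (inside G Aᶜ) c')
    (hx : ∀ i, ∀ f ∈ inside G A, x i ∈ f → c f ≠ 0)
    (hy : ∀ i, ∀ f ∈ inside G Aᶜ, y i ∈ f → c' f ≠ 0)
    (hd : ∀ i, ∀ t ∈ seen c (inside G A) (x i), t ∉ seen c' (inside G Aᶜ) (y i)) : False := by
  obtain ⟨C, hC, hCA, hCB⟩ := hc.glue hc' fun a ha b hb hab => by
    obtain ⟨i, rfl, rfl⟩ := h.cut a ha b hb hab
    exact Finset.disjoint_left.2 (hd i)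
  set E := inside G A ∪ inside G Aᶜ
  have hnE : ∀ f ∈ G.edgeSet, f ∉ E → ∃ i, f = s(x i, y i) := by
    intro f hf hfE
    induction f with | _ a b
    have hab : G.Adj a b := hf
    by_cases ha : a ∈ A <;> by_cases hb : b ∈ A
    · exact absurd (.inl (mem_inside.2 ⟨hab, ha, hb⟩)) hfE
    · obtain ⟨i, rfl, rfl⟩ := h.cut a ha b hb hab
      exact ⟨i, rfl⟩
    · obtain ⟨i, rfl, rfl⟩ := h.cut b hb a ha hab.symm
      exact ⟨i, Sym2.eq_swap⟩
    · exact absurd (.inr (mem_inside.2 ⟨hab, ha, hb⟩)) hfE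
  have hfree : ∀ f ∈ E, ∀ i, x i ∈ f ∨ y i ∈ f → C f ≠ 0 := by
    rintro f (hf | hf) i (hi | hi)
    · rw [hCA f hf]
      exact hx i f hf hi
    · exact absurd (hf.2 _ hi) (h.mem_y i)
    · exact absurd (h.mem_x i) (hf.2 _ hi)
    · rw [hCB f hf]
      exact hy i f hf hi
  refine hG.not_goodOn (c := fun e => if e ∈ E then C e else 0) ⟨?_, ?_, fun e _ _ v _ => hG.cubic v⟩
  · intro e he f hf hne hce hcf v hve hvf
    by_cases heE : e ∈ E <;> by_cases hfE : f ∈ E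
    · rw [if_pos heE] at hce
      rw [if_pos hfE] at hcf
      exact hC.zero e heE f hfE hne hce hcf v hve hvf
    · rw [if_pos heE] at hce
      obtain ⟨i, rfl⟩ := hnE f hf hfE
      rcases Sym2.mem_iff.1 hvf with rfl | rfl
      · exact hfree e heE i (.inl hve) hce
      · exact hfree e heE i (.inr hve) hce
    · rw [if_pos hfE] at hcf
      obtain ⟨i, rfl⟩ := hnE e he heE
      rcases Sym2.mem_iff.1 hve with rfl | rfl
      · exact hfree f hfE i (.inl hvf) hcf
      · exact hfree f hfE i (.inr hvf) hcf
    · obtain ⟨i, rfl⟩ := hnE e he heE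
      obtain ⟨j, rfl⟩ := hnE f hf hfE
      have hxy : ∀ i j, x i ≠ y j := fun i j hij => h.mem_y j (hij ▸ h.mem_x i)
      have hij : i ≠ j := by
        rintro rfl
        exact hne rfl
      have := h.inj_x.ne hij
      have := h.inj_y.ne hij
      have := hxy i j
      have := hxy j i
      simp only [Sym2.mem_iff] at hve hvf
      grind
  · intro e he f hf hne hcef hce
    have heE : e ∈ E := by
      by_contra heE
      exact hce (if_neg heE)
    have hfE : f ∈ E := by
      by_contra hfE
      exact hce (hcef.trans (if_neg hfE))
    rw [if_pos heE, if_pos hfE] at hcef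
    rw [if_pos heE] at hce
    exact hC.pos e heE f hfE hne hcef hce

lemma ThreeCut.exists_outer (h : ThreeCut G A x y) (hG : MinCounter V G) :
    ∃ c, GoodOn G (inside G Aᶜ) c ∧ ∀ i, ∀ f ∈ inside G Aᶜ, y i ∈ f → c f ≠ 0 := by
  obtain ⟨c, hc⟩ := hG.exists_within Aᶜ (h.adj 0) fun h' => (mem_inside.1 h').2.1 (h.mem_x 0)
  refine ⟨c, hc.goodOn_inside _ (fun a ha b hb hab => ⟨hab, ha, hb⟩) fun v _ _ => hG.cubic v, ?_⟩
  intro i f hf hif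
  obtain ⟨z, rfl⟩ := Sym2.mem_iff_exists.1 hif
  obtain ⟨h1, h2, h3⟩ := mem_inside.1 hf
  refine hc.ne_zero ⟨h1, h2, h3⟩ ((Set.ncard_le_ncard ?_).trans (hG.1.ncard_diff_le (h.adj i).symm))
  rintro w ⟨hw, -, hwA⟩
  refine ⟨hw, ?_⟩
  rintro rfl
  exact hwA (h.mem_x i)

lemma MinCounter.exists_third (hG : MinCounter V G) {u a b : V} (ha : G.Adj u a)
    (hb : G.Adj u b) (hab : a ≠ b) :
    ∃ p, p ≠ a ∧ p ≠ b ∧ ∀ z, G.Adj u z ↔ z = a ∨ z = b ∨ z = p := by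
  obtain ⟨p, hp⟩ : ∃ p, G.neighborSet u \ {a, b} = {p} := by
    rw [← Set.ncard_eq_one]
    have hsub : ({a, b} : Set V) ⊆ G.neighborSet u := by
      rintro z (rfl | rfl) <;> assumption
    rw [Set.ncard_sdiff hsub, Set.ncard_pair hab, hG.cubic u]
  simp only [Set.ext_iff, Set.mem_sdiff, mem_neighborSet, Set.mem_insert_iff,
    Set.mem_singleton_iff] at hp
  refine ⟨p, ?_, ?_, ?_⟩ <;> grind

open Classical in
/-- No triangle of a minimal counterexample has three distinct neighbors. -/
lemma ThreeCut.not_triangle (h : ThreeCut G A x y) (hG : MinCounter V G)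
    (hA : ∀ a ∈ A, ∃ i, a = x i) (h01 : G.Adj (x 0) (x 1)) (h02 : G.Adj (x 0) (x 2))
    (h12 : G.Adj (x 1) (x 2)) : False := by
  obtain ⟨c, hc, hcy⟩ := h.exists_outer hG
  set P : Fin 3 → Finset (Fin 8) := fun i => seen c (inside G Aᶜ) (y i) with hP
  have hPc : ∀ i, (P i).card ≤ 2 := fun i =>
    card_seen_inside_le hG.1 c (not_not.2 (h.mem_x i)) (h.adj i).symm
  have hPu : ∀ i j, (P i ∪ P j).card ≤ 4 := fun i j =>
    (Finset.card_union_le _ _).trans (add_le_add (hPc i) (hPc j))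
  obtain ⟨t, ht0, ht⟩ := exists_color (T := P 0 ∪ P 1) ((hPu 0 1).trans (by omega))
  obtain ⟨r, hr0, hr⟩ := exists_color (T := insert t (P 0 ∪ P 2))
    ((Finset.card_insert_le _ _).trans (by have := hPu 0 2; omega))
  obtain ⟨s, hs0, hs⟩ := exists_color (T := insert r (insert t (P 1 ∪ P 2))) <| by
    have := hPu 1 2
    have := Finset.card_insert_le t (P 1 ∪ P 2)
    have := Finset.card_insert_le r (insert t (P 1 ∪ P 2))
    omega
  simp only [Finset.mem_insert, Finset.mem_union, not_or] at ht hr hs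
  set d : Sym2 V → Fin 8 := fun e =>
    if e = s(x 0, x 1) then t else if e = s(x 0, x 2) then r else s with hd
  have hd0 : ∀ e, d e ≠ 0 := by
    intro e
    simp only [hd]
    split_ifs <;> assumption
  have hE : ∀ e ∈ inside G A, e = s(x 0, x 1) ∨ e = s(x 0, x 2) ∨ e = s(x 1, x 2) := by
    intro e he
    induction e with | _ a b
    obtain ⟨hab, ha, hb⟩ := mem_inside.1 he
    obtain ⟨i, rfl⟩ := hA a ha
    obtain ⟨j, rfl⟩ := hA b hb
    have hij : i ≠ j := by
      rintro rfl
      exact hab.ne rfl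
    fin_cases i <;> fin_cases j <;> simp at hij ⊢
  have n01 := h01.ne
  have n02 := h02.ne
  have n12 := h12.ne
  have d01 : d s(x 0, x 1) = t := if_pos rfl
  have d02 : d s(x 0, x 2) = r := by
    simp only [hd, if_true]
    rw [if_neg]
    rw [Sym2.eq_iff]
    grind
  have d12 : d s(x 1, x 2) = s := by
    simp only [hd]
    rw [if_neg, if_neg] <;>
    · rw [Sym2.eq_iff]
      grind
  refine h.false_of_colorings hG (c := d) ⟨?_, ?_, ?_⟩ hc (fun _ f _ _ => hd0 f) hcy ?_
  · exact fun e _ _ _ _ h0 => absurd h0 (hd0 e)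
  · intro e he f hf hne hef
    rcases hE e he with rfl | rfl | rfl <;> rcases hE f hf with rfl | rfl | rfl <;> grind
  · exact fun e _ h0 => absurd h0 (hd0 e)
  · intro i k hk hk'
    change k ∈ P i at hk'
    obtain ⟨-, f, hf, hif, rfl⟩ := mem_seen.1 hk
    rcases hE f hf with rfl | rfl | rfl <;> fin_cases i <;> simp at hif hk' <;> grind

/-- A permutation of the colors that moves the sets `P₁`, `P₂`, `P₃` away from `{s, t}`,
`{s, r}` and `F`. -/
lemma exists_perm_three {P₁ P₂ P₃ F : Finset (Fin 8)} (h₁ : P₁.card ≤ 2) (h₂ : P₂.card ≤ 2)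
    (h₃ : P₃.card ≤ 2) (hF : F.card ≤ 2) (h0 : 0 ∉ P₃) {s t r : Fin 8} (hs : s ≠ 0) (ht : t ≠ 0)
    (hr : r ≠ 0) (hst : s ≠ t) (hsr : s ≠ r) (htr : t ≠ r) :
    ∃ π : Equiv.Perm (Fin 8), π 0 = 0 ∧ (∀ k ∈ P₁, π k ≠ s ∧ π k ≠ t) ∧
      (∀ k ∈ P₂, π k ≠ s ∧ π k ≠ r) ∧ ∀ k ∈ P₃, π k ∉ F := by
  have hu : ∀ {P Q : Finset (Fin 8)} {m n}, P.card ≤ m → Q.card ≤ n → (P ∪ Q).card ≤ m + n :=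
    fun hP hQ => (Finset.card_union_le _ _).trans (add_le_add hP hQ)
  obtain ⟨s', hs'0, hs'⟩ := exists_color (T := P₁ ∪ P₂ ∪ P₃) (hu (hu h₁ h₂) h₃)
  obtain ⟨t', ht'0, ht'⟩ := exists_color (T := insert s' (P₁ ∪ P₃))
    ((Finset.card_insert_le _ _).trans (by have := hu h₁ h₃; omega))
  obtain ⟨r', hr'0, hr'⟩ := exists_color (T := insert t' (insert s' (P₂ ∪ P₃))) <| by
    have := hu h₂ h₃
    have := Finset.card_insert_le s' (P₂ ∪ P₃)
    have := Finset.card_insert_le t' (insert s' (P₂ ∪ P₃))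
    omega
  simp only [Finset.mem_insert, Finset.mem_union, not_or] at hs' ht' hr'
  obtain ⟨g, hg, hgS, hgP⟩ := exists_injOn_extension
    (fun k => if k = 0 then 0 else if k = s' then s else if k = t' then t else r)
    {0, s', t', r'} P₃ (by
      intro a ha b hb hab
      simp only [Finset.coe_insert, Finset.coe_singleton, Set.mem_insert_iff,
        Set.mem_singleton_iff] at ha hb
      grind) (fun _ => F) fun k _ _ => by
      have := Finset.card_le_four (a := (0 : Fin 8)) (b := s') (c := t') (d := r')
      have := hu this h₃
      omega
  obtain ⟨π, hπ⟩ := exists_perm_eqOn hg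
  have hS : ∀ k ∈ ({0, s', t', r'} : Finset (Fin 8)),
      π k = if k = 0 then 0 else if k = s' then s else if k = t' then t else r :=
    fun k hk => (hπ k (Finset.mem_union_left _ hk)).trans (hgS k hk)
  have hπs : π s' = s := by
    rw [hS s' (by simp)]
    grind
  have hπt : π t' = t := by
    rw [hS t' (by simp)]
    grind
  have hπr : π r' = r := by
    rw [hS r' (by simp)]
    grind
  refine ⟨π, hS 0 (by simp), ?_, ?_, ?_⟩
  · refine fun k hk => ⟨?_, ?_⟩ <;> intro h
    · exact hs'.1.1 (π.injective (h.trans hπs.symm) ▸ hk)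
    · exact ht'.2.1 (π.injective (h.trans hπt.symm) ▸ hk)
  · refine fun k hk => ⟨?_, ?_⟩ <;> intro h
    · exact hs'.1.2 (π.injective (h.trans hπs.symm) ▸ hk)
    · exact hr'.2.2.1 (π.injective (h.trans hπr.symm) ▸ hk)
  · intro k hk
    rw [hπ k (Finset.mem_union_right _ hk)]
    refine hgP k hk ?_
    simp only [Finset.mem_insert, Finset.mem_singleton]
    grind

end ThreeCuts

section Sharing

variable {V : Type} [Finite V] {G : SimpleGraph V}

/-- A nontrivial cut with three edges has no two edges sharing a vertex. -/
lemma MinCounter.not_sharing (hG : MinCounter V G) {A : Set V} {x y₁ y₂ x₃ y₃ : V} (hx : x ∈ A)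
    (hA : ∃ a ∈ A, a ≠ x) (hy : y₁ ≠ y₂) (hy₁ : y₁ ∉ A) (hy₂ : y₂ ∉ A) (h₁ : G.Adj x y₁)
    (h₂ : G.Adj x y₂) (hx₃ : x₃ ∈ A) (hy₃ : y₃ ∉ A) (h₃ : G.Adj x₃ y₃)
    (hcut : ∀ a ∈ A, ∀ b ∉ A, G.Adj a b →
      a = x ∧ b = y₁ ∨ a = x ∧ b = y₂ ∨ a = x₃ ∧ b = y₃) : False := by
  obtain ⟨x', hx'₁, hx'₂, hx'⟩ := hG.exists_third h₁ h₂ hy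
  have hxx' : G.Adj x x' := (hx' x').2 (by simp)
  have hcut' : ∀ a ∈ A \ {x}, ∀ b ∉ A \ {x}, G.Adj a b →
      a = x' ∧ b = x ∨ a = x₃ ∧ b = y₃ := by
    rintro a ⟨ha, hax⟩ b hb hab
    rw [Set.mem_singleton_iff] at hax
    by_cases hbA : b ∈ A
    · obtain rfl : b = x := by
        by_contra hbx
        exact hb ⟨hbA, hbx⟩
      rcases (hx' a).1 hab.symm with rfl | rfl | rfl
      · exact absurd ha hy₁
      · exact absurd ha hy₂
      · exact .inl ⟨rfl, rfl⟩
    · have := hcut a ha b hbA hab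
      tauto
  have hxA : x ∉ A \ {x} := fun h => h.2 rfl
  by_cases hxx₃ : x₃ = x
  · subst hxx₃
    by_cases hx'A : x' ∈ A
    · refine hG.not_cut_one (A := A \ {x₃}) ⟨hx'A, hxx'.ne'⟩ hxA hxx'.symm fun a ha b hb hab => ?_
      rcases hcut' a ha b hb hab with h | h
      · exact h
      · exact absurd h.1 ha.2
    · obtain ⟨a, ha, hax⟩ := hA
      obtain ⟨u, hu, v, hv, huv⟩ := hG.exists_cut (A := A \ {x₃}) ⟨a, ha, hax⟩ ⟨x₃, hxA⟩
      rcases hcut' u hu v hv huv with ⟨rfl, -⟩ | ⟨rfl, -⟩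
      · exact hx'A hu.1
      · exact hu.2 rfl
  have hx'A : x' ∈ A := by
    by_contra h
    rcases hcut x hx x' h hxx' with h | h | h
    · exact hx'₁ h.2
    · exact hx'₂ h.2
    · exact hxx₃ h.1.symm
  have hxy₃ : x ≠ y₃ := by
    rintro rfl
    exact hy₃ hx
  by_cases hx'₃ : x' = x₃
  · subst hx'₃
    obtain ⟨t, htx, hty, ht⟩ := hG.exists_third hxx'.symm h₃ hxy₃
    have hxt : G.Adj x' t := (ht t).2 (by simp)
    have htA : t ∈ A := by
      by_contra h
      rcases hcut x' hx'A t h hxt with h | h | h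
      · exact hxx₃ h.1
      · exact hxx₃ h.1
      · exact hty h.2
    refine hG.not_cut_one (A := (A \ {x}) \ {x'}) (a := t) (b := x') ⟨⟨htA, htx⟩, hxt.ne'⟩
      (fun h => h.2 rfl) hxt.symm fun a ha b hb hab => ?_
    by_cases hbx : b = x'
    · subst hbx
      rcases (ht a).1 hab.symm with rfl | rfl | rfl
      · exact absurd rfl ha.1.2
      · exact absurd ha.1.1 hy₃
      · exact ⟨rfl, rfl⟩
    · rcases hcut' a ha.1 b (fun h => hb ⟨h, hbx⟩) hab with h | h
      · exact absurd h.1 ha.2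
      · exact absurd h.1 ha.2
  · exact hG.not_twoCut (A := A \ {x}) (B := (A \ {x})ᶜ) (a₁ := x') (b₁ := x) (a₂ := x₃) (b₂ := y₃)
      { compl := rfl
        mem_a₁ := ⟨hx'A, hxx'.ne'⟩
        mem_a₂ := ⟨hx₃, hxx₃⟩
        mem_b₁ := hxA
        mem_b₂ := fun h => hy₃ h.1
        ne_a := hx'₃
        ne_b := hxy₃
        adj₁ := hxx'.symm
        adj₂ := h₃
        cut := hcut' }

variable {A : Set V} {x y : Fin 3 → V}

open Classical in
/-- The side of a cut with three edges two of which are joined by an edge has a coloring in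
which the ends of these two edges see a common color. -/
lemma ThreeCut.exists_inner (h : ThreeCut G A x y) (hG : MinCounter V G)
    (h01 : G.Adj (x 0) (x 1)) {p q : V} (hpA : p ∈ A) (hqA : q ∈ A)
    (hp : ∀ z, G.Adj (x 0) z ↔ z = y 0 ∨ z = x 1 ∨ z = p)
    (hq : ∀ z, G.Adj (x 1) z ↔ z = y 1 ∨ z = x 0 ∨ z = q)
    (hp1 : p ≠ x 1) (hq0 : q ≠ x 0) (hpq : p ≠ q) :
    ∃ c s t r, GoodOn G (inside G A) c ∧ (∀ i, ∀ f ∈ inside G A, x i ∈ f → c f ≠ 0) ∧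
      s ≠ 0 ∧ t ≠ 0 ∧ r ≠ 0 ∧ s ≠ t ∧ s ≠ r ∧ t ≠ r ∧
      seen c (inside G A) (x 0) ⊆ {s, t} ∧ seen c (inside G A) (x 1) ⊆ {s, r} := by
  have h0p : G.Adj (x 0) p := (hp p).2 (by simp)
  have h1q : G.Adj (x 1) q := (hq q).2 (by simp)
  have hy0A := h.mem_y 0
  have hy1A := h.mem_y 1
  set W : Set V := A \ {x 0, x 1} with hW
  have mW : ∀ z, z ∈ W ↔ z ∈ A ∧ z ≠ x 0 ∧ z ≠ x 1 := by simp [hW]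
  have hpW : p ∈ W := (mW p).2 ⟨hpA, h0p.ne', hp1⟩
  have hqW : q ∈ W := (mW q).2 ⟨hqA, hq0, h1q.ne'⟩
  have h0W : x 0 ∉ W := fun h => ((mW _).1 h).2.1 rfl
  have h1W : x 1 ∉ W := fun h => ((mW _).1 h).2.2 rfl
  set H : SimpleGraph V := within G W ⊔ edge (x 0) p ⊔ edge (x 0) q with hH
  have hHadj : ∀ u v, H.Adj u v ↔ (G.Adj u v ∧ u ∈ W ∧ v ∈ W) ∨
      (u = x 0 ∧ (v = p ∨ v = q)) ∨ (v = x 0 ∧ (u = p ∨ u = q)) := by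
    intro u v
    have : (within G W).Adj u v ↔ G.Adj u v ∧ u ∈ W ∧ v ∈ W := Iff.rfl
    simp only [hH, sup_adj, edge_adj, this]
    have := h0p.ne
    grind
  have hHle : ∀ u v, u ≠ q → u ≠ x 0 → H.Adj u v → G.Adj u v ∧ v ∈ A := by
    intro u v hu hu0 huv
    rcases (hHadj u v).1 huv with ⟨h1, -, h2⟩ | ⟨rfl, -⟩ | ⟨rfl, rfl | rfl⟩
    · exact ⟨h1, ((mW v).1 h2).1⟩
    · exact absurd rfl hu0
    · exact ⟨h0p.symm, h.mem_x 0⟩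
    · exact absurd rfl hu
  have hHx0 : (H.neighborSet (x 0)).ncard ≤ 2 := by
    refine (Set.ncard_le_ncard (t := {p, q}) ?_).trans (Set.ncard_pair hpq).le
    intro v hv
    rcases (hHadj _ v).1 hv with ⟨-, h1, -⟩ | ⟨-, h1⟩ | ⟨rfl, h1⟩
    · exact absurd h1 h0W
    · exact h1
    · grind
  have hHq : (H.neighborSet q).ncard ≤ (G.neighborSet q ∩ (A \ {x 1})).ncard + 1 := by
    refine (Set.ncard_le_ncard (t := insert (x 0) (G.neighborSet q ∩ (A \ {x 1}))) ?_).trans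
      (Set.ncard_insert_le _ _)
    intro v hv
    rcases (hHadj _ v).1 hv with ⟨h1, -, h2⟩ | ⟨h1, -⟩ | ⟨rfl, -⟩
    · exact .inr ⟨h1, ((mW v).1 h2).1, ((mW v).1 h2).2.2⟩
    · exact absurd h1 hq0
    · exact .inl rfl
  have hsub : Subcubic H := by
    intro u
    by_cases hu : u = q
    · subst hu
      have := (Set.ncard_le_ncard (s := G.neighborSet u ∩ (A \ {x 1}))
        (t := G.neighborSet u \ {x 1}) fun v hv => ⟨hv.1, hv.2.2⟩).trans
          (hG.1.ncard_diff_le h1q.symm)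
      omega
    by_cases hu0 : u = x 0
    · subst hu0
      omega
    · exact (Set.ncard_le_ncard fun v hv => (hHle u v hu hu0 hv).1).trans (hG.1 u)
  have hlt : H.edgeSet.ncard < G.edgeSet.ncard := by
    refine edgeSet_ncard_lt (R := {s(x 0, y 0), s(x 0, x 1)}) (S := {s(x 0, q)}) ?_ ?_ ?_
    · rintro _ (rfl | rfl)
      exacts [h.adj 0, h01]
    · intro e he
      induction e with | _ u v
      have hv0 : y 0 ≠ x 0 := fun h' => hy0A (h' ▸ h.mem_x 0)
      have n01 := h01.ne
      have hyp : y 0 ≠ p := fun h' => hy0A (h' ▸ hpA)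
      have := h0p.symm
      simp only [Set.mem_union, Set.mem_sdiff, Set.mem_insert_iff, Set.mem_singleton_iff,
        Sym2.eq_iff, mem_edgeSet] at he ⊢
      rcases (hHadj u v).1 he with ⟨h1, h2, h3⟩ | ⟨rfl, rfl | rfl⟩ | ⟨rfl, rfl | rfl⟩ <;> grind
    · rw [Set.ncard_singleton, Set.ncard_pair]
      · exact one_lt_two
      · intro h'
        rcases Sym2.eq_iff.1 h' with h' | h'
        · exact hy0A (h'.2 ▸ h.mem_x 1)
        · exact h01.ne h'.1
  obtain ⟨c, hc⟩ := hG.exists_good H hsub hlt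
  have H0p : H.Adj (x 0) p := (hHadj _ _).2 (by simp)
  have H0q : H.Adj (x 0) q := (hHadj _ _).2 (by simp)
  set t := c s(x 0, p) with ht
  set r := c s(x 0, q) with hr
  have ht0 : t ≠ 0 := hc.ne_zero H0p hHx0
  have hr0 : r ≠ 0 := hc.ne_zero H0q hHx0
  have htr : t ≠ r := by
    intro htr
    refine (hc.1.2 _ _ _ _ H0p H0q ?_ htr ht0).1.1 rfl
    simp [hpq, h0p.ne']
  have hWH : inside G W ⊆ H.edgeSet := by
    intro e he
    induction e with | _ u v
    exact (hHadj u v).2 (.inl (mem_inside.1 he))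
  have hg : GoodOn G (inside G W) c :=
    hc.goodOn_inside W (fun a ha b hb hab => (hHadj a b).2 (.inl ⟨hab, ha, hb⟩))
      fun v _ _ => hG.cubic v
  have n0 : ∀ z, s(x 0, z) ∉ inside G W := fun z hz => h0W (mem_inside.1 hz).2.1
  have n1 : ∀ z, s(x 1, z) ∉ inside G W := fun z hz => h1W (mem_inside.1 hz).2.1
  have hseen : ∀ w ∈ W, H.Adj (x 0) w → ∀ z, z = w ∨ G.Adj w z →
      c s(x 0, w) ∉ seen c (inside G W) z := by
    intro w hw hw' z hz
    by_cases hzW : z ∈ W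
    · refine hc.notMem_seen hWH hw' (n0 w) ?_
      rcases hz with rfl | hz
      · exact .inr (.inl hw')
      · exact .inr (.inr ((hHadj _ _).2 (.inl ⟨hz, hw, hzW⟩)))
    · exact seen_inside_of_notMem hzW _
  have hg₁ := hg.extend (inside_subset W) (n0 p) ht0 (t := t) (a := x 0) (b := p) (by
    rintro z (⟨hz, hzp⟩ | ⟨hz, -⟩)
    · rcases (hp z).1 hz with rfl | rfl | rfl
      · exact seen_inside_of_notMem (fun h' => hy0A h'.1) _
      · exact seen_inside_of_notMem h1W _
      · exact absurd rfl hzp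
    · exact hseen p hpW H0p z (.inr hz))
  set c₁ := Function.update c s(x 0, p) t
  have hE₁ : insert s(x 0, p) (inside G W) ⊆ G.edgeSet :=
    Set.insert_subset h0p (inside_subset W)
  have hne₂ : s(x 1, q) ∉ insert s(x 0, p) (inside G W) := by
    rintro (h' | h')
    · rcases Sym2.eq_iff.1 h' with h' | h'
      · exact h01.ne h'.1.symm
      · exact hp1 h'.1.symm
    · exact n1 q h'
  have hr₁ : ∀ z, r ∉ seen c (inside G W) z → r ∉ seen c₁ (insert s(x 0, p) (inside G W)) z := by
    intro z hz hz'
    rcases Finset.mem_insert.1 (seen_update_subset z hz') with h' | h'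
    · exact htr h'.symm
    · exact hz h'
  have hg₂ := hg₁.extend hE₁ hne₂ hr0 (t := r) (a := x 1) (b := q) (by
    rintro z (⟨hz, hzq⟩ | ⟨hz, -⟩)
    · refine hr₁ z ?_
      rcases (hq z).1 hz with rfl | rfl | rfl
      · exact seen_inside_of_notMem (fun h' => hy1A h'.1) _
      · exact seen_inside_of_notMem h0W _
      · exact absurd rfl hzq
    · exact hr₁ z (hseen q hqW H0q z (.inr hz)))
  set c₂ := Function.update c₁ s(x 1, q) r
  set E₂ := insert s(x 1, q) (insert s(x 0, p) (inside G W))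
  have hE₂ : E₂ ⊆ G.edgeSet := Set.insert_subset h1q hE₁
  obtain ⟨s, hs0, hs⟩ := exists_color (T := seen c₂ E₂ p ∪ seen c₂ E₂ q) <|
    (Finset.card_union_le _ _).trans
      (add_le_add (card_seen_le_three hG.1 c₂ hE₂ p) (card_seen_le_three hG.1 c₂ hE₂ q))
  rw [Finset.mem_union, not_or] at hs
  have e01p : s(x 0, x 1) ≠ s(x 0, p) := by simp [hp1.symm, h0p.ne]
  have e01q : s(x 0, x 1) ≠ s(x 1, q) := by simp [hq0.symm, h01.ne]
  have epq : s(x 0, p) ≠ s(x 1, q) := by simp [h01.ne, hq0.symm]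
  have hne₃ : s(x 0, x 1) ∉ E₂ := by
    rintro (h' | h' | h')
    · exact e01q h'
    · exact e01p h'
    · exact n0 _ h'
  have hc₂t : c₂ s(x 0, p) = t := by simp [c₂, c₁, epq]
  have hc₂r : c₂ s(x 1, q) = r := by simp [c₂]
  have hst : s ≠ t := by
    rintro rfl
    exact hs.1 (mem_seen.2 ⟨ht0, _, .inr (.inl rfl), by simp, hc₂t⟩)
  have hsr : s ≠ r := by
    rintro rfl
    exact hs.2 (mem_seen.2 ⟨hr0, _, .inl rfl, by simp, hc₂r⟩)
  have hE₂A : ∀ z ∉ A, s ∉ seen c₂ E₂ z := by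
    intro z hz hz'
    obtain ⟨-, f, hf, hzf, -⟩ := mem_seen.1 hz'
    rcases hf with rfl | rfl | hf
    · rcases Sym2.mem_iff.1 hzf with rfl | rfl
      exacts [hz (h.mem_x 1), hz hqA]
    · rcases Sym2.mem_iff.1 hzf with rfl | rfl
      exacts [hz (h.mem_x 0), hz hpA]
    · exact hz (hf.2 z hzf).1
  have hg₃ := hg₂.extend hE₂ hne₃ hs0 (t := s) (a := x 0) (b := x 1) (by
    rintro z (⟨hz, hz'⟩ | ⟨hz, hz'⟩)
    · rcases (hp z).1 hz with rfl | rfl | rfl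
      exacts [hE₂A _ hy0A, absurd rfl hz', hs.1]
    · rcases (hq z).1 hz with rfl | rfl | rfl
      exacts [hE₂A _ hy1A, absurd rfl hz', hs.2])
  set c₃ := Function.update c₂ s(x 0, x 1) s
  have hc₃s : c₃ s(x 0, x 1) = s := by simp [c₃]
  have hc₃t : c₃ s(x 0, p) = t := by simp [c₃, e01p.symm, hc₂t]
  have hc₃r : c₃ s(x 1, q) = r := by simp [c₃, e01q.symm, hc₂r]
  have hc₃ : ∀ f ∈ inside G W, c₃ f = c f := by
    intro f hf
    have h1 : f ≠ s(x 0, x 1) := fun h' => n0 _ (h' ▸ hf)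
    have h2 : f ≠ s(x 1, q) := fun h' => n1 _ (h' ▸ hf)
    have h3 : f ≠ s(x 0, p) := fun h' => n0 _ (h' ▸ hf)
    simp [c₃, c₂, c₁, h1, h2, h3]
  have hA : ∀ f ∈ inside G A, f = s(x 0, x 1) ∨ f = s(x 1, q) ∨ f = s(x 0, p) ∨
      f ∈ inside G W := by
    have key : ∀ u v, G.Adj u v → u ∈ A → v ∈ A → u = x 0 ∨ u = x 1 →
        s(u, v) = s(x 0, x 1) ∨ s(u, v) = s(x 1, q) ∨ s(u, v) = s(x 0, p) := by
      rintro u v huv - hv (rfl | rfl)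
      · rcases (hp v).1 huv with rfl | rfl | rfl
        exacts [absurd hv hy0A, .inl rfl, .inr (.inr rfl)]
      · rcases (hq v).1 huv with rfl | rfl | rfl
        exacts [absurd hv hy1A, .inl Sym2.eq_swap, .inr (.inl rfl)]
    intro f hf
    induction f with | _ u v
    obtain ⟨huv, hu, hv⟩ := mem_inside.1 hf
    by_cases hu' : u = x 0 ∨ u = x 1
    · have := key u v huv hu hv hu'
      tauto
    by_cases hv' : v = x 0 ∨ v = x 1
    · have := key v u huv.symm hv hu hv'
      rw [Sym2.eq_swap (a := v)] at this
      tauto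
    · rw [not_or] at hu' hv'
      exact .inr (.inr (.inr (mem_inside.2 ⟨huv, (mW u).2 ⟨hu, hu'⟩, (mW v).2 ⟨hv, hv'⟩⟩)))
  have hHx2 : (H.neighborSet (x 2)).ncard ≤ 2 := by
    have n20 : x 2 ≠ x 0 := h.inj_x.ne (by decide)
    have hy2 : ∀ v ∈ A, v ≠ y 2 := fun v hv hvy => h.mem_y 2 (hvy ▸ hv)
    by_cases h2q : x 2 = q
    · subst h2q
      have hle : (G.neighborSet (x 2) ∩ (A \ {x 1})).ncard ≤ 1 :=
        (Set.ncard_le_ncard (t := G.neighborSet (x 2) \ {x 1, y 2}) fun v hv => ⟨hv.1, by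
          rintro (rfl | rfl)
          exacts [hv.2.2 rfl, hy2 _ hv.2.1 rfl]⟩).trans
          (hG.1.ncard_diff_pair_le h1q.symm (h.adj 2) (hy2 _ (h.mem_x 1)))
      omega
    · exact (Set.ncard_le_ncard (t := G.neighborSet (x 2) \ {y 2}) fun v hv =>
        ⟨(hHle _ v h2q n20 hv).1,
        hy2 v (hHle _ v h2q n20 hv).2⟩).trans (hG.1.ncard_diff_le (h.adj 2))
  refine ⟨c₃, s, t, r, hg₃.mono ?_, ?_, hs0, ht0, hr0, hst, hsr, htr, ?_, ?_⟩
  · exact fun f hf => hA f hf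
  · intro i f hf hif
    rcases hA f hf with rfl | rfl | rfl | hf
    · rwa [hc₃s]
    · rwa [hc₃r]
    · rwa [hc₃t]
    · rw [hc₃ f hf]
      obtain ⟨z, rfl⟩ := Sym2.mem_iff_exists.1 hif
      refine hc.ne_zero (hWH hf) ?_
      fin_cases i
      · exact absurd hf (n0 z)
      · exact absurd hf (n1 z)
      · exact hHx2
  · intro k hk
    obtain ⟨-, f, hf, hif, rfl⟩ := mem_seen.1 hk
    rcases hA f hf with rfl | rfl | rfl | hf
    · simp [hc₃s]
    · simp [h01.ne, hq0.symm] at hif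
    · simp [hc₃t]
    · exact absurd (hf.2 _ hif) h0W
  · intro k hk
    obtain ⟨-, f, hf, hif, rfl⟩ := mem_seen.1 hk
    rcases hA f hf with rfl | rfl | rfl | hf
    · simp [hc₃s]
    · simp [hc₃r]
    · simp [h01.ne', hp1.symm] at hif
    · exact absurd (hf.2 _ hif) h1W

/-- No two edges of a cut with three disjoint edges are joined by an edge inside a side. -/
lemma ThreeCut.not_adj (h : ThreeCut G A x y) (hG : MinCounter V G)
    (h01 : G.Adj (x 0) (x 1)) : False := by
  have hxy : ∀ i j, x i ≠ y j := fun i j hij => h.mem_y j (hij ▸ h.mem_x i)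
  have hin : ∀ i z, G.Adj (x i) z → z ≠ y i → z ∈ A := by
    intro i z hz hzy
    by_contra hzA
    obtain ⟨j, hj, rfl⟩ := h.cut _ (h.mem_x i) z hzA hz
    exact hzy (congrArg y (h.inj_x hj).symm)
  obtain ⟨p, hpy, hp1, hp⟩ := hG.exists_third (h.adj 0) h01 (hxy 1 0).symm
  obtain ⟨q, hqy, hq0, hq⟩ := hG.exists_third (h.adj 1) h01.symm (hxy 0 1).symm
  have h0p : G.Adj (x 0) p := (hp p).2 (by simp)
  have h1q : G.Adj (x 1) q := (hq q).2 (by simp)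
  have hpA := hin 0 p h0p hpy
  have hqA := hin 1 q h1q hqy
  by_cases hpq : p = q
  · subst hpq
    obtain ⟨t, ht0, ht1, ht⟩ := hG.exists_third h0p.symm h1q.symm h01.ne
    have hpt : G.Adj p t := (ht t).2 (by simp)
    have hty : ∀ i : Fin 3, p ≠ x i → t ≠ y i := by
      rintro i hpi rfl
      obtain ⟨j, rfl, hj⟩ := h.cut p hpA _ (h.mem_y i) hpt
      exact hpi (congrArg x (h.inj_y hj).symm)
    have hty0 := hty 0 h0p.ne'
    have hty1 := hty 1 h1q.ne'
    have hy01 := h.inj_y.ne (show (0 : Fin 3) ≠ 1 by decide)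
    have n01 := h01.ne
    have n0p := h0p.ne
    have n1p := h1q.ne
    refine ThreeCut.not_triangle (A := {x 0, x 1, p}) (x := ![x 0, x 1, p]) (y := ![y 0, y 1, t])
      ⟨?_, ?_, ?_, ?_, ?_, ?_⟩ hG ?_ h01 h0p h1q
    · intro i
      fin_cases i <;> simp
    · have h00 := hxy 0 0
      have h10 := hxy 1 0
      have hp0 : p ≠ y 0 := hpy
      have h01' := hxy 0 1
      have h11 := hxy 1 1
      have hpt' := hpt.ne
      intro i
      fin_cases i <;> simp [*, h00.symm, h10.symm, hp0.symm, h01'.symm, h11.symm, hqy.symm, hpt'.symm]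
    · intro i
      fin_cases i
      · exact h.adj 0
      · exact h.adj 1
      · exact hpt
    · intro i j hij
      fin_cases i <;> fin_cases j <;> simp at hij ⊢ <;> grind
    · intro i j hij
      fin_cases i <;> fin_cases j <;> simp at hij ⊢ <;> grind
    · intro a ha b hb hab
      simp only [Set.mem_insert_iff, Set.mem_singleton_iff, not_or] at ha hb
      rcases ha with rfl | rfl | rfl
      · refine ⟨0, rfl, ?_⟩
        have := (hp b).1 hab
        simp only [Matrix.cons_val_zero]
        tauto
      · refine ⟨1, rfl, ?_⟩
        have := (hq b).1 hab
        simp only [Matrix.cons_val_one, Matrix.cons_val_zero]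
        tauto
      · refine ⟨2, rfl, ?_⟩
        have := (ht b).1 hab
        simp only [Matrix.cons_val]
        tauto
    · rintro a (rfl | rfl | rfl)
      exacts [⟨0, rfl⟩, ⟨1, rfl⟩, ⟨2, rfl⟩]
  obtain ⟨c, s, t, r, hc, hcx, hs, ht, hr, hst, hsr, htr, hS₀, hS₁⟩ :=
    h.exists_inner hG h01 hpA hqA hp hq hp1 hq0 hpq
  obtain ⟨c', hc', hcy⟩ := h.exists_outer hG
  have hP : ∀ i, (seen c' (inside G Aᶜ) (y i)).card ≤ 2 := fun i =>
    card_seen_inside_le hG.1 c' (not_not.2 (h.mem_x i)) (h.adj i).symm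
  obtain ⟨π, hπ0, hπ₁, hπ₂, hπ₃⟩ := exists_perm_three (hP 0) (hP 1) (hP 2)
    (card_seen_inside_le hG.1 c (h.mem_y 2) (h.adj 2)) (fun h0 => (mem_seen.1 h0).1 rfl)
    hs ht hr hst hsr htr
  refine h.false_of_colorings hG hc (hc'.perm π hπ0) hcx ?_ ?_
  · intro i f hf hif h0
    exact hcy i f hf hif (π.injective (h0.trans hπ0.symm))
  · intro i k hk hk'
    obtain ⟨j, hj, rfl⟩ := (mem_seen_perm hπ0).1 hk'
    fin_cases i
    · have := hS₀ hk
      have := hπ₁ j hj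
      grind
    · have := hS₁ hk
      have := hπ₂ j hj
      grind
    · exact hπ₃ j hj hk

end Sharing

section Cuts

variable {V : Type} {G : SimpleGraph V} {A : Set V} {x y : Fin 3 → V}

lemma ThreeCut.symm (h : ThreeCut G A x y) : ThreeCut G Aᶜ y x where
  mem_x := h.mem_y
  mem_y i := not_not.2 (h.mem_x i)
  adj i := (h.adj i).symm
  inj_x := h.inj_y
  inj_y := h.inj_x
  cut a ha b hb hab :=
    let ⟨i, hi⟩ := h.cut b (not_not.1 hb) a ha hab.symm
    ⟨i, hi.symm⟩

variable [Finite V]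

lemma MinCounter.cut_injective (hG : MinCounter V G) (hA : 2 ≤ A.ncard) (hx : ∀ i, x i ∈ A)
    (hy : ∀ i, y i ∉ A) (hxy : ∀ i, G.Adj (x i) (y i))
    (hne : ∀ i j, x i = x j → y i = y j → i = j)
    (hcut : ∀ a ∈ A, ∀ b ∉ A, G.Adj a b → ∃ i, a = x i ∧ b = y i) : Function.Injective x := by
  intro i j hij
  by_contra hn
  obtain ⟨k, hk⟩ : ∃ k, ∀ l, l = i ∨ l = j ∨ l = k := by
    have : ∀ i j : Fin 3, i ≠ j → ∃ k, ∀ l, l = i ∨ l = j ∨ l = k := by decide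
    exact this i j hn
  obtain ⟨a, ha, hax⟩ := Set.exists_ne_of_one_lt_ncard hA (x i)
  refine hG.not_sharing (hx i) ⟨a, ha, hax⟩ (fun h => hn (hne i j hij h)) (hy i) (hy j) (hxy i)
    (hij ▸ hxy j) (hx k) (hy k) (hxy k) fun a ha b hb hab => ?_
  obtain ⟨l, rfl, rfl⟩ := hcut a ha b hb hab
  rcases hk l with rfl | rfl | rfl
  exacts [.inl ⟨rfl, rfl⟩, .inr (.inl ⟨hij.symm, rfl⟩), .inr (.inr ⟨rfl, rfl⟩)]

lemma MinCounter.exists_threeCut (hG : MinCounter V G) (hA : 2 ≤ A.ncard) (hA' : 2 ≤ Aᶜ.ncard)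
    (hcut : (cutEdges G A).ncard = 3) {e f : Sym2 V} (he : e ∈ cutEdges G A)
    (hf : f ∈ cutEdges G A) (hef : e ≠ f) :
    ∃ x y, ThreeCut G A x y ∧ e = s(x 0, y 0) ∧ f = s(x 1, y 1) := by
  obtain ⟨g, hg⟩ : ∃ g, cutEdges G A \ {e, f} = {g} := by
    rw [← Set.ncard_eq_one, Set.ncard_sdiff (by rintro _ (rfl | rfl) <;> assumption),
      Set.ncard_pair hef, hcut]
  have hg' : g ∈ cutEdges G A \ {e, f} := hg ▸ rfl
  have hall : ∀ i, ![e, f, g] i ∈ cutEdges G A := by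
    intro i
    fin_cases i
    exacts [he, hf, hg'.1]
  choose hE x hx y hy hxy using hall
  have hinj : Function.Injective ![e, f, g] := by
    have h1 : g ≠ e := fun h => hg'.2 (.inl h)
    have h2 : g ≠ f := fun h => hg'.2 (.inr h)
    intro i j hij
    fin_cases i <;> fin_cases j <;> simp at hij ⊢ <;> grind
  have hne : ∀ i j, x i = x j → y i = y j → i = j := fun i j h1 h2 =>
    hinj (by rw [hxy i, hxy j, h1, h2])
  have hadj : ∀ i, G.Adj (x i) (y i) := fun i => by
    have := hE i
    rwa [hxy i] at this
  have hcov : ∀ a ∈ A, ∀ b ∉ A, G.Adj a b → ∃ i, a = x i ∧ b = y i := by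
    intro a ha b hb hab
    obtain ⟨i, hi⟩ : ∃ i, s(a, b) = ![e, f, g] i := by
      by_cases h1 : s(a, b) = e
      · exact ⟨0, h1⟩
      by_cases h2 : s(a, b) = f
      · exact ⟨1, h2⟩
      have h3 : s(a, b) ∈ cutEdges G A \ {e, f} := ⟨⟨hab, a, ha, b, hb, rfl⟩, by simp [h1, h2]⟩
      rw [hg] at h3
      exact ⟨2, h3⟩
    rw [hxy i, Sym2.eq_iff] at hi
    rcases hi with hi | hi
    · exact ⟨i, hi⟩
    · exact absurd (hi.2 ▸ hx i) hb
  refine ⟨x, y, ⟨hx, hy, hadj, hG.cut_injective hA hx hy hadj hne hcov, ?_, hcov⟩, hxy 0, hxy 1⟩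
  refine hG.cut_injective hA' hy (fun i => not_not.2 (hx i)) (fun i => (hadj i).symm)
    (fun i j h1 h2 => hne i j h2 h1) fun a ha b hb hab => ?_
  obtain ⟨i, hi⟩ := hcov b (not_not.1 hb) a ha hab.symm
  exact ⟨i, hi.symm⟩

end Cuts

/-- In a minimal counterexample, a nontrivial edge cut of size three (both sides of the
partition having at least two vertices) is an induced matching: no two of its edges share
a vertex and no edge of `G` joins two of its edges. -/
theorem minCounter_three_cut_induced {V : Type} [Finite V] (G : SimpleGraph V)
    (hG : MinCounter V G)
    (X : Set V) (hX : 2 ≤ X.ncard) (hXc : 2 ≤ Xᶜ.ncard)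
    (hcut : (cutEdges G X).ncard = 3) :
    ∀ e ∈ cutEdges G X, ∀ f ∈ cutEdges G X, e ≠ f →
      ∀ u v : V, u ∈ e → v ∈ f → u ≠ v ∧ ¬G.Adj u v := by
  intro e he f hf hef u v hu hv
  obtain ⟨x, y, h, rfl, rfl⟩ := hG.exists_threeCut hX hXc hcut he hf hef
  have h01 : (0 : Fin 3) ≠ 1 := by decide
  have hmixed : ∀ i j, i ≠ j → x i ≠ y j ∧ ¬G.Adj (x i) (y j) := by
    refine fun i j hij => ⟨fun hx => h.mem_y j (hx ▸ h.mem_x i), fun hadj => ?_⟩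
    obtain ⟨k, hi, hj⟩ := h.cut _ (h.mem_x i) _ (h.mem_y j) hadj
    exact hij ((h.inj_x hi).trans (h.inj_y hj).symm)
  rcases Sym2.mem_iff.1 hu with rfl | rfl <;> rcases Sym2.mem_iff.1 hv with rfl | rfl
  · exact ⟨h.inj_x.ne h01, h.not_adj hG⟩
  · exact hmixed 0 1 h01
  · exact ⟨(hmixed 1 0 h01.symm).1.symm, fun hadj => (hmixed 1 0 h01.symm).2 hadj.symm⟩
  · exact ⟨h.inj_y.ne h01, h.symm.not_adj hG⟩
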